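/- For every integer n ≥ 3, the posets NC^B(n-1,1) and NC^B(n) are not order-isomorphic. -/

import Mathlib

/-!  Common setup: annular non-crossing partitions of type B, following
Goulden–Nica–Oancea, "Enumerative properties of NC^(B)(p,q)". -/

/-- The underlying set `{±1, …, ±n}`, realized inside `ℤ`. -/
def signedSet (n : ℕ) : Set ℤ := {x : ℤ | x ≠ 0 ∧ |x| ≤ (n : ℤ)}

/-- Membership in the hyperoctahedral group `B_n`, realized as the permutations of `ℤ`
that commute with negation and fix every point outside `{±1, …, ±n}`. -/
def inB (n : ℕ) (π : Equiv.Perm ℤ) : Prop :=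
  (∀ x : ℤ, π (-x) = -(π x)) ∧ ∀ x : ℤ, x ∉ signedSet n → π x = x

/-- The set of generators of `B_n`:
`(i,j)(-i,-j)`, `(i,-j)(-i,j)` for `1 ≤ i ≠ j ≤ n`, and `(i,-i)` for `1 ≤ i ≤ n`. -/
def genB (n : ℕ) : Set (Equiv.Perm ℤ) :=
  {π | (∃ i j : ℤ, 1 ≤ i ∧ i ≤ (n : ℤ) ∧ 1 ≤ j ∧ j ≤ (n : ℤ) ∧ i ≠ j ∧
          π = Equiv.swap i j * Equiv.swap (-i) (-j)) ∨
       (∃ i j : ℤ, 1 ≤ i ∧ i ≤ (n : ℤ) ∧ 1 ≤ j ∧ j ≤ (n : ℤ) ∧ i ≠ j ∧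
          π = Equiv.swap i (-j) * Equiv.swap (-i) j) ∨
       (∃ i : ℤ, 1 ≤ i ∧ i ≤ (n : ℤ) ∧ π = Equiv.swap i (-i))}

/-- The length function `ℓ_B` on `B_n`: the least `k` such that `τ` is a product of `k`
generators from `genB n` (the empty product being the identity). -/
noncomputable def lenB (n : ℕ) (τ : Equiv.Perm ℤ) : ℕ :=
  sInf {k : ℕ | ∃ l : List (Equiv.Perm ℤ),
    l.length = k ∧ (∀ g ∈ l, g ∈ genB n) ∧ l.prod = τ}

/-- The partial order on `B_n`:  `τ ≤ σ` iff `ℓ_B(σ) = ℓ_B(τ) + ℓ_B(τ⁻¹σ)`. -/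
def leB (n : ℕ) (τ σ : Equiv.Perm ℤ) : Prop :=
  lenB n σ = lenB n τ + lenB n (τ⁻¹ * σ)

/-- The permutation `γ_{p,q} = (1,…,p,-1,…,-p)(p+1,…,p+q,-(p+1),…,-(p+q))`. -/
def gammaPQ (p q : ℕ) : Equiv.Perm ℤ :=
  (((List.range p).map fun i => ((i : ℤ) + 1)) ++
      ((List.range p).map fun i => -((i : ℤ) + 1))).formPerm *
    (((List.range q).map fun i => ((p : ℤ) + (i : ℤ) + 1)) ++
      ((List.range q).map fun i => -((p : ℤ) + (i : ℤ) + 1))).formPerm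

/-- The long cycle `γ_n = (1,…,n,-1,…,-n)` of `B_n` (disc case). -/
def gammaDisc (n : ℕ) : Equiv.Perm ℤ :=
  (((List.range n).map fun i => ((i : ℤ) + 1)) ++
    ((List.range n).map fun i => -((i : ℤ) + 1))).formPerm

/-- The annular non-crossing permutations of type B: `S^B_nc(p,q) = [ε, γ_{p,q}] ⊆ B_{p+q}`. -/
def SncB (p q : ℕ) : Set (Equiv.Perm ℤ) :=
  {τ | inB (p + q) τ ∧ leB (p + q) τ (gammaPQ p q)}

/-- The orbit of `x` under the permutation `τ`. -/
def permOrbit (τ : Equiv.Perm ℤ) (x : ℤ) : Set ℤ := {y | ∃ m : ℤ, (τ ^ m) x = y}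

/-- The partition `Ω(τ)` of `{±1,…,±n}` into orbits of `τ`. -/
def orbitsOn (n : ℕ) (τ : Equiv.Perm ℤ) : Set (Set ℤ) :=
  {A | ∃ x ∈ signedSet n, A = permOrbit τ x}

/-- The negation `-A` of a set `A ⊆ ℤ`. -/
def negSet (A : Set ℤ) : Set ℤ := {x | -x ∈ A}

/-- The partition `Ω̃(τ)`, obtained from `Ω(τ)` by merging all inversion-invariant orbits
(orbits `A` with `A = -A`) into a single block. -/
def omegaTilde (n : ℕ) (τ : Equiv.Perm ℤ) : Set (Set ℤ) :=
  {A | A ∈ orbitsOn n τ ∧ negSet A ≠ A} ∪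
    {B | B = ⋃₀ {A | A ∈ orbitsOn n τ ∧ negSet A = A} ∧ B.Nonempty}

/-- The annular non-crossing partitions of type B: `NC^B(p,q) = {Ω̃(τ) : τ ∈ S^B_nc(p,q)}`. -/
def NCB (p q : ℕ) : Set (Set (Set ℤ)) :=
  {π | ∃ τ ∈ SncB p q, π = omegaTilde (p + q) τ}

/-- The type B non-crossing partitions of the disc: `NC^B(n) = {Ω̃(τ) : τ ∈ B_n, τ ≤ γ_n}`. -/
def NCBdisc (n : ℕ) : Set (Set (Set ℤ)) :=
  {π | ∃ τ, inB n τ ∧ leB n τ (gammaDisc n) ∧ π = omegaTilde n τ}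

/-- Reverse refinement order on partitions: every block of `π` is contained in a block of `ρ`. -/
def refines (π ρ : Set (Set ℤ)) : Prop := ∀ A ∈ π, ∃ B ∈ ρ, A ⊆ B

/-- The rank of a partition of `{±1,…,±n}`:
`n` minus half the number of blocks `A` with `A ≠ -A`. -/
noncomputable def rankNCB (n : ℕ) (π : Set (Set ℤ)) : ℕ :=
  n - {A | A ∈ π ∧ negSet A ≠ A}.ncard / 2

/-- The inner point set `{±(p+1), …, ±(p+q)}`. -/
def innerSet (p q : ℕ) : Set ℤ := {x : ℤ | (p : ℤ) < |x| ∧ |x| ≤ (p : ℤ) + (q : ℤ)}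

/-- The connectivity of `π ∈ NC^B(p,q)`: half the number of blocks `A` with `A ≠ -A`
meeting both `{±1,…,±p}` and `{±(p+1),…,±(p+q)}`. -/
noncomputable def connectivity (p q : ℕ) (π : Set (Set ℤ)) : ℕ :=
  {A | A ∈ π ∧ negSet A ≠ A ∧ (A ∩ signedSet p).Nonempty ∧
    (A ∩ innerSet p q).Nonempty}.ncard / 2

/-- The number of exterior pairs of blocks `{A, -A}` (with `A ≠ -A`, `A ⊆ {±1,…,±p}`). -/
noncomputable def extPairs (p : ℕ) (π : Set (Set ℤ)) : ℕ :=
  {A | A ∈ π ∧ negSet A ≠ A ∧ A ⊆ signedSet p}.ncard / 2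

/-- The number of interior pairs of blocks `{A, -A}`
(with `A ≠ -A`, `A ⊆ {±(p+1),…,±(p+q)}`). -/
noncomputable def intPairs (p q : ℕ) (π : Set (Set ℤ)) : ℕ :=
  {A | A ∈ π ∧ negSet A ≠ A ∧ A ⊆ innerSet p q}.ncard / 2

/-- The minimum `0̂` of `NC^B(p,q)` (with `n = p+q`): the partition into singletons. -/
def botNCB (n : ℕ) : Set (Set ℤ) := {A | ∃ x ∈ signedSet n, A = {x}}

/-- The maximum `1̂` of `NC^B(p,q)` (with `n = p+q`): the partition with a single block. -/
def topNCB (n : ℕ) : Set (Set ℤ) := {signedSet n}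

/-- The orbit of `x` under the subgroup generated by `{τ, γ}`. -/
def jointOrbit (τ γ : Equiv.Perm ℤ) (x : ℤ) : Set ℤ :=
  {y | ∃ g ∈ Subgroup.closure ({τ, γ} : Set (Equiv.Perm ℤ)), g x = y}

/-- The orbits on `{±1,…,±n}` of the subgroup generated by `{τ, γ}`. -/
def jointOrbitsOn (n : ℕ) (τ γ : Equiv.Perm ℤ) : Set (Set ℤ) :=
  {Y | ∃ x ∈ signedSet n, Y = jointOrbit τ γ x}



open Module in
theorem nb_rank_null {E E' : Type*} [AddCommGroup E] [Module ℝ E] [AddCommGroup E'] [Module ℝ E']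
    (W : Submodule ℝ E) [FiniteDimensional ℝ W] (L : E →ₗ[ℝ] E') :
    finrank ℝ (W.map L) + finrank ℝ (W ⊓ LinearMap.ker L : Submodule ℝ E) = finrank ℝ W := by
  have h := LinearMap.finrank_range_add_finrank_ker (L.domRestrict W)
  have h1 : LinearMap.range (L.domRestrict W) = W.map L := by
    ext x; simp [Submodule.mem_map]
  have h2 : (LinearMap.ker (L.domRestrict W)).map W.subtype = W ⊓ LinearMap.ker L := by
    ext x
    simp only [Submodule.mem_map, LinearMap.mem_ker, Submodule.mem_inf]
    constructor
    · rintro ⟨y, hy, rfl⟩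
      exact ⟨y.2, hy⟩
    · rintro ⟨hx, hy⟩
      exact ⟨⟨x, hx⟩, hy, rfl⟩
  have h3 := Submodule.finrank_map_subtype_eq W (LinearMap.ker (L.domRestrict W))
  rw [h1] at h
  rw [h2] at h3
  omega

open Module in
theorem nb_codim_one {E : Type*} [AddCommGroup E] [Module ℝ E]
    (W : Submodule ℝ E) [FiniteDimensional ℝ W] (L : E →ₗ[ℝ] ℝ) :
    finrank ℝ W ≤ finrank ℝ (W ⊓ LinearMap.ker L : Submodule ℝ E) + 1 := by
  have h := nb_rank_null W L
  have h2 := Submodule.finrank_le (W.map L)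
  simp at h2
  omega

/-- odd functions supported on signedSet -/
def nbV (n : ℕ) : Submodule ℝ (ℤ → ℝ) where
  carrier := {f | (∀ x, f (-x) = - f x) ∧ ∀ x, x ∉ signedSet n → f x = 0}
  add_mem' := by
    rintro a b ⟨h1, h2⟩ ⟨h3, h4⟩
    refine ⟨fun x => by simp [h1, h3]; ring, fun x hx => by simp [h2 x hx, h4 x hx]⟩
  zero_mem' := by simp
  smul_mem' := by
    rintro c a ⟨h1, h2⟩
    refine ⟨fun x => by simp [h1], fun x hx => by simp [h2 x hx]⟩

theorem nb_mem_V {n : ℕ} {f : ℤ → ℝ} : f ∈ nbV n ↔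
    (∀ x, f (-x) = - f x) ∧ ∀ x, x ∉ signedSet n → f x = 0 := Iff.rfl

theorem nb_mem_signed {n : ℕ} {x : ℤ} : x ∈ signedSet n ↔ x ≠ 0 ∧ -(n:ℤ) ≤ x ∧ x ≤ n := by
  simp only [signedSet, Set.mem_ofPred_eq, abs_le]

instance nbV_fin (n : ℕ) : FiniteDimensional ℝ (nbV n) := by
  let L : (nbV n) →ₗ[ℝ] ((Finset.Icc (-(n:ℤ)) n) → ℝ) :=
    (LinearMap.funLeft ℝ ℝ (fun i : (Finset.Icc (-(n:ℤ)) n) => (i : ℤ))).comp (nbV n).subtype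
  apply Module.Finite.of_injective L
  intro a b hab
  ext x
  by_cases hx : x ∈ signedSet n
  · have := congrFun hab ⟨x, by rw [nb_mem_signed] at hx; simp; omega⟩
    simpa [L, LinearMap.funLeft] using this
  · rw [a.2.2 x hx, b.2.2 x hx]

theorem nb_fin_of_le {n : ℕ} {W : Submodule ℝ (ℤ → ℝ)} (h : W ≤ nbV n) : FiniteDimensional ℝ W :=
  Submodule.finiteDimensional_of_le h

noncomputable def nbN (n : ℕ) : ℕ := Module.finrank ℝ (nbV n)

/-- fixed space -/
def nbF (n : ℕ) (τ : Equiv.Perm ℤ) : Submodule ℝ (ℤ → ℝ) where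
  carrier := {f | f ∈ nbV n ∧ ∀ x, f (τ x) = f x}
  add_mem' := by
    rintro a b ⟨h1, h2⟩ ⟨h3, h4⟩
    exact ⟨add_mem h1 h3, fun x => by simp [h2, h4]⟩
  zero_mem' := ⟨zero_mem _, by simp⟩
  smul_mem' := by
    rintro c a ⟨h1, h2⟩
    exact ⟨Submodule.smul_mem _ _ h1, fun x => by simp [h2]⟩

theorem nb_mem_F {n : ℕ} {τ : Equiv.Perm ℤ} {f : ℤ → ℝ} :
    f ∈ nbF n τ ↔ f ∈ nbV n ∧ ∀ x, f (τ x) = f x := Iff.rfl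

theorem nbF_le (n : ℕ) (τ : Equiv.Perm ℤ) : nbF n τ ≤ nbV n := fun _ h => h.1

instance nbF_fin (n : ℕ) (τ : Equiv.Perm ℤ) : FiniteDimensional ℝ (nbF n τ) :=
  nb_fin_of_le (nbF_le n τ)

def nbDiff (x y : ℤ) : (ℤ → ℝ) →ₗ[ℝ] ℝ := (LinearMap.proj x : (ℤ → ℝ) →ₗ[ℝ] ℝ) - (LinearMap.proj y : (ℤ → ℝ) →ₗ[ℝ] ℝ)

/-- hyperplane -/
def nbH (n : ℕ) (x y : ℤ) : Submodule ℝ (ℤ → ℝ) := nbV n ⊓ LinearMap.ker (nbDiff x y)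

theorem nb_mem_H {n : ℕ} {x y : ℤ} {f : ℤ → ℝ} : f ∈ nbH n x y ↔ f ∈ nbV n ∧ f x = f y := by
  simp [nbH, nbDiff, sub_eq_zero]

theorem nbH_le (n : ℕ) (x y : ℤ) : nbH n x y ≤ nbV n := fun _ h => h.1

instance nbH_fin (n : ℕ) (x y : ℤ) : FiniteDimensional ℝ (nbH n x y) :=
  nb_fin_of_le (nbH_le n x y)

theorem nbH_finrank (n : ℕ) (x y : ℤ) : nbN n ≤ Module.finrank ℝ (nbH n x y) + 1 :=
  nb_codim_one (nbV n) (nbDiff x y)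

theorem nbF_one (n : ℕ) : nbF n 1 = nbV n := by
  ext f; simp [nb_mem_F]

theorem nb_lt_rank {n : ℕ} {W W' : Submodule ℝ (ℤ → ℝ)} (h' : W' ≤ nbV n) (h : W < W') :
    Module.finrank ℝ W < Module.finrank ℝ W' := by
  have := nb_fin_of_le h'
  exact Submodule.finrank_lt_finrank_of_lt h

theorem nb_le_rank {n : ℕ} {W W' : Submodule ℝ (ℤ → ℝ)} (h' : W' ≤ nbV n) (h : W ≤ W') :
    Module.finrank ℝ W ≤ Module.finrank ℝ W' := by
  have := nb_fin_of_le h'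
  exact Submodule.finrank_mono h

theorem nb_eq_rank {n : ℕ} {W W' : Submodule ℝ (ℤ → ℝ)} (h' : W' ≤ nbV n) (h : W ≤ W')
    (hr : Module.finrank ℝ W' ≤ Module.finrank ℝ W) : W = W' := by
  have := nb_fin_of_le h'
  exact Submodule.eq_of_le_of_finrank_le h hr

/-- basic vector -/
def nbδ (m : ℤ) : ℤ → ℝ := fun z => if z = m then 1 else if z = -m then -1 else 0

theorem nbδ_mem {n : ℕ} {m : ℤ} (h : m ∈ signedSet n) : nbδ m ∈ nbV n := by
  rw [nb_mem_signed] at h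
  refine ⟨fun x => ?_, fun x hx => ?_⟩
  · unfold nbδ
    split_ifs <;> first | omega | simp
  · rw [nb_mem_signed] at hx
    unfold nbδ
    split_ifs <;> first | omega | simp

theorem nb_zero {n : ℕ} {f : ℤ → ℝ} (hf : f ∈ nbV n) : f 0 = 0 :=
  hf.2 0 (by simp [signedSet])

/-! group facts -/
theorem nb_inB_one (n : ℕ) : inB n 1 := ⟨fun _ => rfl, fun _ _ => rfl⟩

theorem nb_inB_mul {n : ℕ} {σ τ : Equiv.Perm ℤ} (h : inB n σ) (h' : inB n τ) : inB n (σ * τ) :=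
  ⟨fun x => by simp [h.1, h'.1], fun x hx => by simp [h.2 x hx, h'.2 x hx]⟩

theorem nb_inB_inv {n : ℕ} {σ : Equiv.Perm ℤ} (h : inB n σ) : inB n σ⁻¹ :=
  ⟨fun x => by rw [Equiv.Perm.inv_eq_iff_eq, h.1]; simp,
   fun x hx => by rw [Equiv.Perm.inv_eq_iff_eq, h.2 x hx]⟩

theorem nb_inB_mem {n : ℕ} {σ : Equiv.Perm ℤ} (h : inB n σ) {x : ℤ} (hx : x ∈ signedSet n) :
    σ x ∈ signedSet n := by
  by_contra hc
  have := h.2 _ hc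
  rw [σ.injective this] at hc
  exact hc hx

theorem nb_inB_mem_iff {n : ℕ} {σ : Equiv.Perm ℤ} (h : inB n σ) {x : ℤ} :
    σ x ∈ signedSet n ↔ x ∈ signedSet n := by
  refine ⟨fun hx => ?_, nb_inB_mem h⟩
  by_contra hc
  rw [h.2 x hc] at hx
  exact hc hx

theorem nb_comp_mem {n : ℕ} {σ : Equiv.Perm ℤ} (h : inB n σ) {f : ℤ → ℝ} (hf : f ∈ nbV n) :
    (fun x => f (σ x)) ∈ nbV n :=
  ⟨fun x => by simp [h.1, hf.1], fun x hx => hf.2 _ (by rwa [nb_inB_mem_iff h])⟩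

/-- reflections -/
def nbg (x y : ℤ) : Equiv.Perm ℤ :=
  if y = -x then Equiv.swap x y else Equiv.swap x y * Equiv.swap (-x) (-y)

theorem nbg_apply {x y : ℤ} (hx : x ≠ 0) (hy : y ≠ 0) (hxy : x ≠ y) (z : ℤ) :
    nbg x y z = if z = x then y else if z = y then x else
      if z = -x then -y else if z = -y then -x else z := by
  unfold nbg
  split_ifs with h h1 h2 h3 h4 <;> simp only [Equiv.Perm.mul_apply, Equiv.swap_apply_def] <;>
    split_ifs <;> omega

/-- valid pair -/
def nbOK (n : ℕ) (x y : ℤ) : Prop := x ∈ signedSet n ∧ y ∈ signedSet n ∧ x ≠ y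

theorem nbg_inB {n : ℕ} {x y : ℤ} (h : nbOK n x y) : inB n (nbg x y) := by
  obtain ⟨hx, hy, hxy⟩ := h
  rw [nb_mem_signed] at hx hy
  refine ⟨fun z => ?_, fun z hz => ?_⟩
  · rw [nbg_apply hx.1 hy.1 hxy, nbg_apply hx.1 hy.1 hxy]
    split_ifs <;> omega
  · rw [nb_mem_signed] at hz
    rw [nbg_apply hx.1 hy.1 hxy]
    split_ifs <;> omega

theorem nbg_sq {n : ℕ} {x y : ℤ} (h : nbOK n x y) : nbg x y * nbg x y = 1 := by
  obtain ⟨hx, hy, hxy⟩ := h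
  rw [nb_mem_signed] at hx hy
  ext z
  simp only [Equiv.Perm.mul_apply, nbg_apply hx.1 hy.1 hxy, Equiv.Perm.one_apply]
  split_ifs <;> omega

theorem nbg_inv {n : ℕ} {x y : ℤ} (h : nbOK n x y) : (nbg x y)⁻¹ = nbg x y :=
  inv_eq_of_mul_eq_one_left (nbg_sq h)

theorem nbg_mem {n : ℕ} {x y : ℤ} (h : nbOK n x y) : nbg x y ∈ genB n := by
  obtain ⟨hx, hy, hxy⟩ := h
  rw [nb_mem_signed] at hx hy
  by_cases h1 : y = -x
  · right; right
    subst h1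
    rcases lt_or_gt_of_ne hx.1 with h | h
    · exact ⟨-x, by omega, by omega, by simp [nbg, Equiv.swap_comm]⟩
    · exact ⟨x, by omega, by omega, by simp [nbg]⟩
  · have e : nbg x y = Equiv.swap x y * Equiv.swap (-x) (-y) := by simp [nbg, h1]
    have e2 : nbg x y = Equiv.swap (-x) (-y) * Equiv.swap x y := by
      rw [e]; ext z
      simp only [Equiv.Perm.mul_apply, Equiv.swap_apply_def]
      split_ifs <;> omega
    rcases lt_or_gt_of_ne hx.1 with h | h <;> rcases lt_or_gt_of_ne hy.1 with h' | h'
    · left; exact ⟨-x, -y, by omega, by omega, by omega, by omega, by omega, by simpa using e2⟩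
    · right; left
      exact ⟨-x, y, by omega, by omega, by omega, by omega, by omega, by simpa using e2⟩
    · right; left
      exact ⟨x, -y, by omega, by omega, by omega, by omega, by omega, by simpa using e⟩
    · left; exact ⟨x, y, by omega, by omega, by omega, by omega, by omega, by simpa using e⟩

theorem nbg_of_mem {n : ℕ} {g : Equiv.Perm ℤ} (h : g ∈ genB n) :
    ∃ x y, nbOK n x y ∧ g = nbg x y := by
  rcases h with ⟨i, j, h1, h2, h3, h4, h5, rfl⟩ | ⟨i, j, h1, h2, h3, h4, h5, rfl⟩ | ⟨i, h1, h2, rfl⟩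
  · refine ⟨i, j, ⟨?_, ?_, ?_⟩, ?_⟩
    · rw [nb_mem_signed]; omega
    · rw [nb_mem_signed]; omega
    · omega
    · rw [nbg, if_neg (by omega)]
  · refine ⟨i, -j, ⟨?_, ?_, ?_⟩, ?_⟩
    · rw [nb_mem_signed]; omega
    · rw [nb_mem_signed]; omega
    · omega
    · rw [nbg, if_neg (by omega)]; simp
  · refine ⟨i, -i, ⟨?_, ?_, ?_⟩, ?_⟩
    · rw [nb_mem_signed]; omega
    · rw [nb_mem_signed]; omega
    · omega
    · rw [nbg, if_pos rfl]

theorem nbg_fix {n : ℕ} {x y : ℤ} (h : nbOK n x y) {f : ℤ → ℝ} (ho : ∀ z, f (-z) = - f z)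
    (hf : f x = f y) (z : ℤ) : f (nbg x y z) = f z := by
  obtain ⟨hx, hy, hxy⟩ := h
  rw [nbg_apply hx.1 hy.1 hxy]
  split_ifs with h1 h2 h3 h4
  · rw [h1, hf]
  · rw [h2, hf]
  · rw [h3, ho, ho, hf]
  · rw [h4, ho, ho, hf]
  · rfl

theorem nbF_g {n : ℕ} {x y : ℤ} (h : nbOK n x y) : nbF n (nbg x y) = nbH n x y := by
  ext f
  rw [nb_mem_F, nb_mem_H]
  refine and_congr_right fun hf => ⟨fun h' => ?_, fun h' => nbg_fix h hf.1 h'⟩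
  have := h' x
  rw [nbg_apply h.1.1 h.2.1.1 h.2.2, if_pos rfl] at this
  exact this.symm

theorem nb_d_gmul {n : ℕ} {x y : ℤ} (h : nbOK n x y) (τ : Equiv.Perm ℤ) :
    Module.finrank ℝ (nbF n τ) ≤ Module.finrank ℝ (nbF n (nbg x y * τ)) + 1 := by
  refine (nb_codim_one (nbF n τ) (nbDiff x y)).trans ?_
  refine Nat.add_le_add_right (Submodule.finrank_mono ?_) 1
  rintro f ⟨hf, hf2⟩
  refine ⟨hf.1, fun z => ?_⟩
  have : f x = f y := by simpa [nbDiff, sub_eq_zero] using hf2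
  rw [Equiv.Perm.mul_apply, nbg_fix h hf.1.1 this, hf.2]

/-- Carter step -/
theorem nb_carter {n : ℕ} {τ : Equiv.Perm ℤ} (hτ : inB n τ) (h1 : τ ≠ 1) :
    ∃ x, nbOK n x (τ x) ∧ nbF n τ ≤ nbH n x (τ x) ∧ nbF n τ < nbF n (nbg x (τ x) * τ) := by
  obtain ⟨x, hx⟩ : ∃ x, τ x ≠ x := by
    by_contra hc
    push Not at hc
    exact h1 (Equiv.ext hc)
  have hxs : x ∈ signedSet n := by
    by_contra hc
    exact hx (hτ.2 x hc)
  have ok : nbOK n x (τ x) := ⟨hxs, nb_inB_mem hτ hxs, hx.symm⟩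
  refine ⟨x, ok, fun f hf => ?_, ?_⟩
  · exact nb_mem_H.2 ⟨hf.1, (hf.2 x).symm⟩
  · refine SetLike.lt_iff_le_and_exists.2 ⟨fun f hf => ⟨hf.1, fun z => ?_⟩, nbδ x, ?_, ?_⟩
    · rw [Equiv.Perm.mul_apply, nbg_fix ok hf.1.1 (hf.2 x).symm, hf.2]
    · refine ⟨nbδ_mem hxs, fun z => ?_⟩
      have hfx : (nbg x (τ x) * τ) x = x := by
        rw [Equiv.Perm.mul_apply, nbg_apply ok.1.1 ok.2.1.1 ok.2.2, if_neg hx, if_pos rfl]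
      have hB := nb_inB_mul (nbg_inB ok) hτ
      have hfx' : (nbg x (τ x) * τ) (-x) = -x := by rw [hB.1, hfx]
      unfold nbδ
      congr 1
      · simp only [eq_iff_iff]
        exact ⟨fun h => (nbg x (τ x) * τ).injective (by rw [h, hfx]), fun h => by rw [h, hfx]⟩
      · congr 1
        simp only [eq_iff_iff]
        exact ⟨fun h => (nbg x (τ x) * τ).injective (by rw [h, hfx']), fun h => by rw [h, hfx']⟩
    · intro hc
      have h3 := hc.2 x
      have := hxs.1
      unfold nbδ at h3
      split_ifs at h3 <;> first | omega | norm_num at h3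

theorem nb_d_le (n : ℕ) (τ : Equiv.Perm ℤ) : Module.finrank ℝ (nbF n τ) ≤ nbN n :=
  nb_le_rank le_rfl (nbF_le n τ)

theorem nb_len_upper {n : ℕ} (k : ℕ) : ∀ τ : Equiv.Perm ℤ, inB n τ →
    nbN n ≤ Module.finrank ℝ (nbF n τ) + k →
    ∃ l : List (Equiv.Perm ℤ), l.length ≤ k ∧ (∀ g ∈ l, g ∈ genB n) ∧ l.prod = τ := by
  induction k with
  | zero =>
    intro τ hτ h
    by_cases h1 : τ = 1
    · exact ⟨[], by simp, by simp, by simp [h1]⟩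
    · obtain ⟨x, ok, -, hlt⟩ := nb_carter hτ h1
      have := nb_lt_rank (nbF_le _ _) hlt
      have := nb_d_le n (nbg x (τ x) * τ)
      omega
  | succ k ih =>
    intro τ hτ h
    by_cases h1 : τ = 1
    · exact ⟨[], by simp, by simp, by simp [h1]⟩
    · obtain ⟨x, ok, -, hlt⟩ := nb_carter hτ h1
      have := nb_lt_rank (nbF_le _ _) hlt
      obtain ⟨l, hl, hg, hp⟩ := ih _ (nb_inB_mul (nbg_inB ok) hτ) (by omega)
      refine ⟨nbg x (τ x) :: l, by simpa using hl, ?_, ?_⟩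
      · intro g hg'
        rcases List.mem_cons.1 hg' with rfl | h
        · exact nbg_mem ok
        · exact hg g h
      · rw [List.prod_cons, hp, ← mul_assoc, nbg_sq ok, one_mul]

theorem nb_len_lower {n : ℕ} (l : List (Equiv.Perm ℤ)) (hl : ∀ g ∈ l, g ∈ genB n) :
    nbN n ≤ Module.finrank ℝ (nbF n l.prod) + l.length := by
  induction l with
  | nil =>
    rw [List.prod_nil, nbF_one]
    simp [nbN]
  | cons g l ih =>
    obtain ⟨x, y, ok, rfl⟩ := nbg_of_mem (hl g (by simp))
    have h1 := ih (fun g hg => hl g (by simp [hg]))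
    have h2 := nb_d_gmul ok l.prod
    rw [List.prod_cons, List.length_cons]
    omega

theorem nb_len {n : ℕ} {τ : Equiv.Perm ℤ} (hτ : inB n τ) :
    lenB n τ + Module.finrank ℝ (nbF n τ) = nbN n := by
  have hd := nb_d_le n τ
  obtain ⟨l, h1, h2, h3⟩ := nb_len_upper (nbN n - Module.finrank ℝ (nbF n τ)) τ hτ (by omega)
  have hm : l.length ∈ {k : ℕ | ∃ l : List (Equiv.Perm ℤ),
    l.length = k ∧ (∀ g ∈ l, g ∈ genB n) ∧ l.prod = τ} := ⟨l, rfl, h2, h3⟩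
  have h4 : lenB n τ ≤ l.length := Nat.sInf_le hm
  obtain ⟨l', h1', h2', h3'⟩ := Nat.sInf_mem ⟨_, hm⟩
  have h5 := nb_len_lower l' h2'
  rw [h3', h1'] at h5
  change _ ≤ _ + lenB n τ at h5
  omega

/-- being below γ -/
def nbS (n : ℕ) (γ τ : Equiv.Perm ℤ) : Prop :=
  inB n τ ∧ nbN n ≤ Module.finrank ℝ (nbF n τ) + Module.finrank ℝ (nbF n (τ⁻¹ * γ))

theorem nb_sum_le {n : ℕ} {γ : Equiv.Perm ℤ} (h0 : nbF n γ = ⊥) (τ : Equiv.Perm ℤ) :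
    Module.finrank ℝ (nbF n τ) + Module.finrank ℝ (nbF n (τ⁻¹ * γ)) ≤ nbN n := by
  have h := Submodule.finrank_sup_add_finrank_inf_eq (nbF n τ) (nbF n (τ⁻¹ * γ))
  have h1 : nbF n τ ⊓ nbF n (τ⁻¹ * γ) = ⊥ := by
    rw [eq_bot_iff, ← h0]
    rintro f ⟨h1, h2⟩
    refine ⟨h1.1, fun x => ?_⟩
    rw [← h2.2 x, ← h1.2 ((τ⁻¹ * γ) x)]
    simp
  rw [h1, finrank_bot] at h
  have := nb_le_rank le_rfl (sup_le (nbF_le n τ) (nbF_le n (τ⁻¹ * γ)))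
  change _ ≤ nbN n at this
  omega

theorem nb_leB_iff {n : ℕ} {γ τ : Equiv.Perm ℤ} (hγ : inB n γ) (h0 : nbF n γ = ⊥) :
    (inB n τ ∧ leB n τ γ) ↔ nbS n γ τ := by
  refine and_congr_right fun hτ => ?_
  have h1 := nb_len hγ
  have h2 := nb_len hτ
  have h3 := nb_len (nb_inB_mul (nb_inB_inv hτ) hγ)
  have h4 := nb_sum_le h0 τ
  rw [h0, finrank_bot] at h1
  unfold leB
  omega


noncomputable def nbip (n : ℕ) (f g : ℤ → ℝ) : ℝ := ∑ z ∈ Finset.Icc (-(n:ℤ)) n, f z * g z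

theorem nbip_add (n : ℕ) (f g h : ℤ → ℝ) : nbip n f (g + h) = nbip n f g + nbip n f h := by
  simp [nbip, mul_add, Finset.sum_add_distrib]

theorem nbip_sub (n : ℕ) (f g h : ℤ → ℝ) : nbip n f (g - h) = nbip n f g - nbip n f h := by
  simp [nbip, mul_sub, Finset.sum_sub_distrib]

theorem nbip_comm (n : ℕ) (f g : ℤ → ℝ) : nbip n f g = nbip n g f := by
  simp [nbip, mul_comm]

theorem nbip_expand (n : ℕ) (f g : ℤ → ℝ) :
    nbip n (f - g) (f - g) = nbip n f f - 2 * nbip n f g + nbip n g g := by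
  rw [nbip_sub, nbip_comm n (f - g) f, nbip_comm n (f - g) g, nbip_sub, nbip_sub, nbip_comm n g f]
  ring

theorem nbip_self {n : ℕ} {f : ℤ → ℝ} (hf : f ∈ nbV n) (h : nbip n f f = 0) : f = 0 := by
  unfold nbip at h
  rw [Finset.sum_eq_zero_iff_of_nonneg (fun _ _ => mul_self_nonneg _)] at h
  ext z
  by_cases hz : z ∈ signedSet n
  · rw [nb_mem_signed] at hz
    simpa using h z (by simp; omega)
  · simpa using hf.2 z hz

theorem nbip_inv {n : ℕ} {σ : Equiv.Perm ℤ} (h : inB n σ) (f g : ℤ → ℝ) :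
    nbip n (fun x => f (σ x)) (fun x => g (σ x)) = nbip n f g := by
  unfold nbip
  refine Finset.sum_equiv σ (fun i => ?_) (fun _ _ => rfl)
  by_cases hi : i = 0
  · have : σ 0 = 0 := h.2 0 (by simp [signedSet])
    rw [hi, this]
  · have hi' : σ i ≠ 0 := by
      intro hc
      have : σ 0 = 0 := h.2 0 (by simp [signedSet])
      exact hi (σ.injective (by rw [hc, this]))
    have := nb_inB_mem_iff h (x := i)
    rw [nb_mem_signed, nb_mem_signed] at this
    simp only [Finset.mem_Icc]
    tauto

theorem nbip_δ {n : ℕ} {f : ℤ → ℝ} (hf : f ∈ nbV n) {x : ℤ} (hx : x ∈ signedSet n) :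
    nbip n f (nbδ x) = 2 * f x := by
  rw [nb_mem_signed] at hx
  unfold nbip
  have : ∀ z, f z * nbδ x z = (if z = x then f z else 0) + (if z = -x then - f z else 0) := by
    intro z
    unfold nbδ
    split_ifs <;> first | omega | simp
  simp only [this, Finset.sum_add_distrib, Finset.sum_ite_eq', Finset.mem_Icc]
  rw [if_pos (by omega), if_pos (by omega), hf.1]
  ring

theorem nb_orth_mem {n : ℕ} {R F : Submodule ℝ (ℤ → ℝ)} (hR : R ≤ nbV n) (hF : F ≤ nbV n)
    (ho : ∀ f ∈ F, ∀ r ∈ R, nbip n f r = 0)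
    (hr : nbN n ≤ Module.finrank ℝ R + Module.finrank ℝ F) {α : ℤ → ℝ} (hα : α ∈ nbV n)
    (hαF : ∀ f ∈ F, nbip n f α = 0) : α ∈ R := by
  have := nb_fin_of_le hR
  have := nb_fin_of_le hF
  have h := Submodule.finrank_sup_add_finrank_inf_eq R F
  have h1 : R ⊓ F = ⊥ := by
    rw [eq_bot_iff]
    rintro f ⟨h1, h2⟩
    exact nbip_self (hR h1) (ho f h2 f h1)
  rw [h1, finrank_bot] at h
  have h2 : R ⊔ F = nbV n := nb_eq_rank le_rfl (sup_le hR hF) (by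
    change nbN n ≤ _
    omega)
  rw [← h2] at hα
  obtain ⟨r, hr, f, hf, rfl⟩ := Submodule.mem_sup.1 hα
  have h3 := hαF f hf
  rw [nbip_add, ho f hf r hr, zero_add] at h3
  rw [nbip_self (hF hf) h3, add_zero]
  exact hr

def nbD (σ : Equiv.Perm ℤ) : (ℤ → ℝ) →ₗ[ℝ] (ℤ → ℝ) := LinearMap.id - LinearMap.funLeft ℝ ℝ σ

theorem nbD_apply (σ : Equiv.Perm ℤ) (f : ℤ → ℝ) : nbD σ f = f - fun x => f (σ x) := rfl

theorem nbD_mem {n : ℕ} {σ : Equiv.Perm ℤ} (h : inB n σ) {f : ℤ → ℝ} (hf : f ∈ nbV n) :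
    nbD σ f ∈ nbV n := by
  rw [nbD_apply]
  exact sub_mem hf (nb_comp_mem h hf)

theorem nbD_ker (n : ℕ) (σ : Equiv.Perm ℤ) : nbV n ⊓ LinearMap.ker (nbD σ) = nbF n σ := by
  ext f
  rw [Submodule.mem_inf, LinearMap.mem_ker, nbD_apply, sub_eq_zero, nb_mem_F]
  refine and_congr_right fun _ => ⟨fun h x => (congrFun h x).symm, fun h => funext fun x => (h x).symm⟩

theorem nbF_inv (n : ℕ) (σ : Equiv.Perm ℤ) : nbF n σ⁻¹ = nbF n σ := by
  ext f
  refine and_congr_right fun _ => ⟨fun h x => ?_, fun h x => ?_⟩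
  · have := h (σ x)
    simpa using this.symm
  · have := h (σ⁻¹ x)
    simpa using this.symm

theorem nb_orth_F {n : ℕ} {σ : Equiv.Perm ℤ} (h : inB n σ) {f w : ℤ → ℝ} (hf : f ∈ nbF n σ) :
    nbip n f (nbD σ w) = 0 := by
  rw [nbD_apply, nbip_sub, ← nbip_inv h f w]
  have : (fun x => f (σ x)) = f := funext hf.2
  rw [this, sub_self]

theorem nb_orth {n : ℕ} {σ : Equiv.Perm ℤ} (h : inB n σ) {α : ℤ → ℝ} (hα : α ∈ nbV n)
    (hαF : ∀ f ∈ nbF n σ, nbip n f α = 0) : ∃ w ∈ nbV n, nbD σ w = α := by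
  have hm : α ∈ (nbV n).map (nbD σ) := by
    refine nb_orth_mem (F := nbF n σ) ?_ (nbF_le n σ) ?_ ?_ hα hαF
    · rintro _ ⟨w, hw, rfl⟩
      exact nbD_mem h hw
    · rintro f hf _ ⟨w, hw, rfl⟩
      exact nb_orth_F h hf
    · have := nb_rank_null (nbV n) (nbD σ)
      rw [nbD_ker] at this
      rw [this]
      exact le_rfl
  exact hm

/-- parity lemma -/
theorem nb_up {n : ℕ} {ρ : Equiv.Perm ℤ} (h : inB n ρ) {x y : ℤ} (ok : nbOK n x y)
    (hF : nbF n ρ ≤ nbH n x y) :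
    Module.finrank ℝ (nbF n ρ) + 1 ≤ Module.finrank ℝ (nbF n (nbg x y * ρ)) := by
  have hα : nbδ x - nbδ y ∈ nbV n := sub_mem (nbδ_mem ok.1) (nbδ_mem ok.2.1)
  have hip : ∀ f ∈ nbV n, nbip n f (nbδ x - nbδ y) = 2 * (f x - f y) := by
    intro f hf
    rw [nbip_sub, nbip_δ hf ok.1, nbip_δ hf ok.2.1]; ring
  obtain ⟨w, hw, hwα⟩ := nb_orth (nb_inB_inv h) hα (by
    intro f hf
    rw [nbF_inv] at hf
    rw [hip f hf.1, (nb_mem_H.1 (hF hf)).2]; simp)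
  have e : (fun z => w (ρ⁻¹ z)) = w - (nbδ x - nbδ y) := by
    rw [← hwα, nbD_apply]; simp
  have hinv := nbip_inv (nb_inB_inv h) w w
  rw [e, nbip_expand, hip w hw, hip _ hα] at hinv
  have hx0 := ok.1.1
  have hy0 := ok.2.1.1
  have hxy := ok.2.2
  have hg : ∀ z, w (nbg x y z) = w z - (nbδ x z - nbδ y z) := by
    intro z
    have ho := hw.1
    rw [nbg_apply hx0 hy0 hxy]
    by_cases hc : y = -x
    · subst hc
      have e1 : nbδ x x = 1 := by simp [nbδ]
      have e2 : nbδ x (-x) = -1 := by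
        unfold nbδ; rw [if_neg (by omega), if_pos rfl]
      have e3 : nbδ (-x) x = -1 := by
        unfold nbδ; rw [if_neg (by omega), if_pos (by omega)]
      have e4 : nbδ (-x) (-x) = 1 := by simp [nbδ]
      simp only [Pi.sub_apply, e1, e2, e3, e4, ho] at hinv
      have : w x = 1 := by linarith
      split_ifs with h1 h2 h3
      · rw [h1, ho, e1, e3]; linarith
      · rw [h2, ho, e2, e4]; linarith
      · omega
      · unfold nbδ
        rw [if_neg h1, if_neg h2, if_neg h2, if_neg (by omega)]; simp
    · have e1 : nbδ x x = 1 := by simp [nbδ]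
      have e2 : nbδ x y = 0 := by
        unfold nbδ; rw [if_neg (by omega), if_neg hc]
      have e3 : nbδ y x = 0 := by
        unfold nbδ; rw [if_neg (by omega), if_neg (by omega)]
      have e4 : nbδ y y = 1 := by simp [nbδ]
      simp only [Pi.sub_apply, e1, e2, e3, e4] at hinv
      have : w x - w y = 1 := by linarith
      have o1 := (nbδ_mem ok.1).1
      have o2 := (nbδ_mem ok.2.1).1
      split_ifs with h1 h2 h3 h4
      · rw [h1, e1, e3]; linarith
      · rw [h2, e2, e4]; linarith
      · rw [h3, ho, ho, o1, o2, e1, e3]; linarith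
      · rw [h4, ho, ho, o1, o2, e2, e4]; linarith
      · unfold nbδ
        rw [if_neg h1, if_neg h3, if_neg h2, if_neg h4]; simp
  have hlt : nbF n ρ < nbF n (nbg x y * ρ) := by
    refine SetLike.lt_iff_le_and_exists.2 ⟨fun f hf => ⟨hf.1, fun z => ?_⟩, w, nb_mem_F.2 ⟨hw, fun z => ?_⟩, ?_⟩
    · rw [Equiv.Perm.mul_apply, nbg_fix ok hf.1.1 (nb_mem_H.1 (hF hf)).2, hf.2]
    · rw [Equiv.Perm.mul_apply, hg]
      have := congrFun e (ρ z)
      have e5 : ρ⁻¹ (ρ z) = z := by simp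
      simp only [e5, Pi.sub_apply] at this
      exact this.symm
    · intro hc
      rw [← nbF_inv] at hc
      have h1 : (fun z => w (ρ⁻¹ z)) = w := funext hc.2
      rw [h1] at e
      have h2 := congrFun e x
      simp only [Pi.sub_apply, nbδ] at h2
      rw [if_pos trivial, if_neg hxy] at h2
      split_ifs at h2 <;> linarith
  exact nb_lt_rank (nbF_le _ _) hlt

/-- the poset as a set of subspaces -/
def nbP (n : ℕ) (γ : Equiv.Perm ℤ) : Set (Submodule ℝ (ℤ → ℝ)) := {W | ∃ τ, nbS n γ τ ∧ W = nbF n τ}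

theorem nbP_le {n : ℕ} {γ : Equiv.Perm ℤ} {W : Submodule ℝ (ℤ → ℝ)} (h : W ∈ nbP n γ) : W ≤ nbV n := by
  obtain ⟨τ, -, rfl⟩ := h
  exact nbF_le n τ

theorem nbP_V (n : ℕ) (γ : Equiv.Perm ℤ) : nbV n ∈ nbP n γ :=
  ⟨1, ⟨nb_inB_one n, by rw [nbF_one]; exact Nat.le_add_right _ _⟩, (nbF_one n).symm⟩

theorem nbP_H {n : ℕ} {γ : Equiv.Perm ℤ} (hγ : inB n γ) (h0 : nbF n γ = ⊥) {x y : ℤ}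
    (ok : nbOK n x y) : nbH n x y ∈ nbP n γ := by
  refine ⟨nbg x y, ⟨nbg_inB ok, ?_⟩, (nbF_g ok).symm⟩
  have h1 := nb_up hγ ok (by rw [h0]; exact bot_le)
  rw [nbg_inv ok, nbF_g ok]
  have := nbH_finrank n x y
  omega

theorem nbP_two {n : ℕ} {γ : Equiv.Perm ℤ} (hγ : inB n γ) (h0 : nbF n γ = ⊥) {x y a b : ℤ}
    (ok : nbOK n x y) (ok' : nbOK n a b)
    (h : ∀ f ∈ nbV n, (∀ z, f (nbg x y (γ z)) = f z) → f a = f b) :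
    nbH n x y ⊓ nbH n a b ∈ nbP n γ := by
  have h1 := nb_up hγ ok (by rw [h0]; exact bot_le)
  have h2 := nb_up (nb_inB_mul (nbg_inB ok) hγ) ok' (fun f hf => nb_mem_H.2 ⟨hf.1, h f hf.1 hf.2⟩)
  have e : (nbg x y * nbg a b)⁻¹ * γ = nbg a b * (nbg x y * γ) := by
    rw [mul_inv_rev, nbg_inv ok, nbg_inv ok', mul_assoc]
  have h3 := nb_sum_le h0 (nbg x y * nbg a b)
  rw [e] at h3
  have hle : nbH n x y ⊓ nbH n a b ≤ nbF n (nbg x y * nbg a b) := by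
    rintro f ⟨hf1, hf2⟩
    rw [SetLike.mem_coe, nb_mem_H] at hf1 hf2
    refine ⟨hf1.1, fun z => ?_⟩
    rw [Equiv.Perm.mul_apply, nbg_fix ok hf1.1.1 hf1.2, nbg_fix ok' hf1.1.1 hf2.2]
  have h4 : nbN n ≤ Module.finrank ℝ (nbH n x y ⊓ nbH n a b : Submodule ℝ (ℤ → ℝ)) + 2 := by
    have h5 := nb_codim_one (nbH n x y) (nbDiff a b)
    have h6 := nbH_finrank n x y
    have h7 : nbH n x y ⊓ LinearMap.ker (nbDiff a b) = nbH n x y ⊓ nbH n a b := by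
      unfold nbH; rw [inf_inf_distrib_left]
      ext f; simp only [Submodule.mem_inf]; tauto
    rw [h7] at h5
    omega
  have h8 := nb_le_rank (nbF_le _ _) hle
  refine ⟨nbg x y * nbg a b, ⟨nb_inB_mul (nbg_inB ok) (nbg_inB ok'), ?_⟩, ?_⟩
  · rw [e]; omega
  · exact nb_eq_rank (nbF_le _ _) hle (by omega)

theorem nbHH_rank {n : ℕ} (x y a b : ℤ) :
    nbN n ≤ Module.finrank ℝ (nbH n x y ⊓ nbH n a b : Submodule ℝ (ℤ → ℝ)) + 2 := by
  have h5 := nb_codim_one (nbH n x y) (nbDiff a b)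
  have h6 := nbH_finrank n x y
  have h7 : nbH n x y ⊓ LinearMap.ker (nbDiff a b) = nbH n x y ⊓ nbH n a b := by
    unfold nbH; rw [inf_inf_distrib_left]
    ext f; simp only [Submodule.mem_inf]; tauto
  rw [h7] at h5
  omega

theorem nbP_step {n : ℕ} {γ : Equiv.Perm ℤ} {W : Submodule ℝ (ℤ → ℝ)} (hW : W ∈ nbP n γ)
    (hne : W ≠ nbV n) : (∃ W' ∈ nbP n γ, W < W' ∧ Module.finrank ℝ W' = Module.finrank ℝ W + 1) ∧
      ∃ x y, nbOK n x y ∧ W ≤ nbH n x y := by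
  obtain ⟨τ, hτ, rfl⟩ := hW
  have h1 : τ ≠ 1 := by
    rintro rfl
    exact hne (nbF_one n)
  obtain ⟨x, ok, hH, hlt⟩ := nb_carter hτ.1 h1
  refine ⟨⟨_, ⟨nbg x (τ x) * τ, ⟨nb_inB_mul (nbg_inB ok) hτ.1, ?_⟩, rfl⟩, hlt, ?_⟩, x, τ x, ok, hH⟩
  · have h2 := nb_lt_rank (nbF_le _ _) hlt
    have h3 := hτ.2
    have h4 : Module.finrank ℝ (nbF n (τ⁻¹ * γ)) ≤
        Module.finrank ℝ (nbF n ((nbg x (τ x) * τ)⁻¹ * γ)) + 1 := by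
      refine (nb_codim_one (nbF n (τ⁻¹ * γ)) (nbDiff (τ⁻¹ x) x)).trans ?_
      refine Nat.add_le_add_right (Submodule.finrank_mono ?_) 1
      rintro f ⟨hf, hf2⟩
      refine ⟨hf.1, fun z => ?_⟩
      have hfx : f (τ⁻¹ x) = f (τ⁻¹ (τ x)) := by simpa [nbDiff, sub_eq_zero] using hf2
      rw [mul_inv_rev, nbg_inv ok, mul_assoc, Equiv.Perm.mul_apply, Equiv.Perm.mul_apply]
      have h6 := nbg_fix ok (f := fun z => f (τ⁻¹ z))
        (fun z => by rw [(nb_inB_inv hτ.1).1, hf.1.1]) hfx (γ z)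
      exact h6.trans (hf.2 z)
    omega
  · have h2 := nb_lt_rank (nbF_le _ _) hlt
    have ok' : nbOK n x (τ x) := ok
    have h3 := nb_d_gmul ok (nbg x (τ x) * τ)
    rw [← mul_assoc, nbg_sq ok, one_mul] at h3
    omega


def nbL (n : ℕ) : List ℤ := ((List.range n).map fun i : ℕ => ((i : ℤ) + 1)) ++
    ((List.range n).map fun i : ℕ => -((i : ℤ) + 1))

theorem nb_mon (n : ℕ) : (do let a ← List.range n; pure (a : ℤ)) =
    (List.range n).map (fun i : ℕ => (i : ℤ)) := by
  simp [List.map_eq_flatMap]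

theorem nb_gL (n : ℕ) : gammaDisc n = (nbL n).formPerm := by
  unfold gammaDisc nbL
  simp only [nb_mon, List.map_map, Function.comp_def]

theorem nbL_len (n : ℕ) : (nbL n).length = n + n := by simp [nbL]

theorem nbL_nodup (n : ℕ) : (nbL n).Nodup := by
  unfold nbL
  rw [List.nodup_append]
  refine ⟨?_, ?_, ?_⟩
  · exact List.Nodup.map (fun a b h => by simpa using h) List.nodup_range
  · exact List.Nodup.map (fun a b h => by simpa using h) List.nodup_range
  · intro a ha b hb
    simp only [List.mem_map] at ha hb
    obtain ⟨i, -, rfl⟩ := ha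
    obtain ⟨j, -, rfl⟩ := hb
    omega

theorem nbL_get1 (n i : ℕ) (h : i < n) : (nbL n)[i]'(by rw [nbL_len]; omega) = (i : ℤ) + 1 := by
  simp [nbL, List.getElem_append, h]

theorem nbL_get2 (n i : ℕ) (h : i < n) : (nbL n)[n + i]'(by rw [nbL_len]; omega) = -((i : ℤ) + 1) := by
  simp [nbL, List.getElem_append]

theorem nbL_apply (n i j : ℕ) (h : i < n + n) (hj : j = (i + 1) % (n + n)) (a b : ℤ)
    (ha : (nbL n)[i]'(by rw [nbL_len]; omega) = a)
    (hb : (nbL n)[j]'(by rw [nbL_len, hj]; exact Nat.mod_lt _ (by omega)) = b) :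
    gammaDisc n a = b := by
  have := List.formPerm_apply_getElem (nbL n) (nbL_nodup n) i (by rw [nbL_len]; omega)
  rw [← ha, ← hb]
  rw [nb_gL]
  rw [this]
  congr 1
  rw [nbL_len, hj]

theorem nbγ_succ (n : ℕ) (x : ℤ) (h1 : 1 ≤ x) (h2 : x < n) : gammaDisc n x = x + 1 := by
  obtain ⟨i, rfl⟩ : ∃ i : ℕ, x = (i : ℤ) + 1 := ⟨(x - 1).toNat, by omega⟩
  refine nbL_apply n i (i + 1) (by omega) (by rw [Nat.mod_eq_of_lt]; omega) _ _
    (nbL_get1 n i (by omega)) ?_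
  rw [nbL_get1 n (i + 1) (by omega)]; push_cast; ring

theorem nbγ_top (n : ℕ) (h : 1 ≤ n) : gammaDisc n n = -1 := by
  refine nbL_apply n (n - 1) (n + 0) (by omega) (by rw [Nat.mod_eq_of_lt] <;> omega) _ _ ?_ ?_
  · rw [nbL_get1 n (n - 1) (by omega)]; omega
  · rw [nbL_get2 n 0 (by omega)]; simp

theorem nbγ_nsucc (n : ℕ) (x : ℤ) (h1 : 1 ≤ x) (h2 : x < n) : gammaDisc n (-x) = -(x + 1) := by
  obtain ⟨i, rfl⟩ : ∃ i : ℕ, x = (i : ℤ) + 1 := ⟨(x - 1).toNat, by omega⟩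
  refine nbL_apply n (n + i) (n + (i + 1)) (by omega) (by rw [Nat.mod_eq_of_lt] <;> omega) _ _
    (nbL_get2 n i (by omega)) ?_
  rw [nbL_get2 n (i + 1) (by omega)]; push_cast; ring

theorem nbγ_ntop (n : ℕ) (h : 1 ≤ n) : gammaDisc n (-n) = 1 := by
  refine nbL_apply n (n + (n - 1)) 0 (by omega) ?_ _ _ ?_ ?_
  · rw [show n + (n - 1) + 1 = n + n by omega, Nat.mod_self]
  · rw [nbL_get2 n (n - 1) (by omega)]; omega
  · rw [nbL_get1 n 0 (by omega)]; simp

theorem nbγ_out (n : ℕ) (x : ℤ) (h : x ∉ signedSet n) : gammaDisc n x = x := by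
  rw [nb_gL]
  refine List.formPerm_apply_of_notMem (l := nbL n) ?_
  intro hc
  apply h
  rw [nb_mem_signed]
  simp only [nbL, List.mem_append, List.mem_map, List.mem_range] at hc
  rcases hc with ⟨i, hi, rfl⟩ | ⟨i, hi, rfl⟩ <;> omega

theorem nbγ_inB (n : ℕ) : inB n (gammaDisc n) := by
  refine ⟨fun x => ?_, fun x hx => nbγ_out n x hx⟩
  by_cases hx : x ∈ signedSet n
  · rw [nb_mem_signed] at hx
    have key : ∀ y : ℤ, 1 ≤ y → y ≤ n → gammaDisc n (-y) = - gammaDisc n y := by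
      intro y h1 h2
      rcases lt_or_eq_of_le h2 with h3 | h3
      · rw [nbγ_succ n y h1 h3, nbγ_nsucc n y h1 h3]
      · rw [h3, nbγ_top n (by omega), nbγ_ntop n (by omega)]; simp
    rcases lt_or_gt_of_ne hx.1 with h | h
    · have := key (-x) (by omega) (by omega)
      rw [neg_neg] at this
      rw [this]; simp
    · exact key x (by omega) (by omega)
  · rw [nbγ_out n x hx, nbγ_out n (-x)]
    rw [nb_mem_signed] at hx ⊢
    omega

theorem nb_chain {f : ℤ → ℝ} {a b : ℤ} (hab : a ≤ b) (h : ∀ x, a ≤ x → x < b → f (x + 1) = f x) :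
    ∀ x, a ≤ x → x ≤ b → f x = f a := by
  intro x hx
  induction x, hx using Int.leInduction with
  | base => intro _; rfl
  | succ m hm ih => 
    intro h2
    rw [h m hm (by omega), ih (by omega)]

theorem nb_const_zero {n p : ℕ} {f : ℤ → ℝ} (hf : f ∈ nbV n) (hp : 1 ≤ p)
    (h : ∀ x : ℤ, 1 ≤ x → x ≤ p → f (gammaDisc p x) = f x) : ∀ x : ℤ, 1 ≤ x → x ≤ p → f x = 0 := by
  have h1 := nb_chain (f := f) (a := 1) (b := p) (by omega) (fun x h1 h2 => by
    rw [← h x h1 h2.le, nbγ_succ p x h1 h2])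
  have h2 := h p (by omega) le_rfl
  rw [nbγ_top p hp, hf.1, h1 p (by omega) le_rfl] at h2
  intro x hx hx'
  rw [h1 x hx hx']
  linarith

theorem nb_zero_of_pos {n : ℕ} {f : ℤ → ℝ} (hf : f ∈ nbV n) 
    (h : ∀ x : ℤ, 1 ≤ x → x ≤ n → f x = 0) : f = 0 := by
  ext x
  by_cases hx : x ∈ signedSet n
  · rw [nb_mem_signed] at hx
    rcases lt_or_gt_of_ne hx.1 with h' | h'
    · have := h (-x) (by omega) (by omega)
      rw [hf.1] at this
      simpa using this
    · exact h x (by omega) (by omega)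
  · exact hf.2 x hx

theorem nbγ_F (n : ℕ) (hn : 1 ≤ n) : nbF n (gammaDisc n) = ⊥ := by
  rw [eq_bot_iff]
  intro f hf
  exact nb_zero_of_pos hf.1 (nb_const_zero hf.1 hn fun x _ _ => hf.2 x)

/-! annular -/
theorem nbpq_eq (p : ℕ) : gammaPQ p 1 = gammaDisc p * Equiv.swap ((p:ℤ)+1) (-((p:ℤ)+1)) := by
  simp [gammaPQ, gammaDisc]

theorem nbpq_lt (p : ℕ) (x : ℤ) (h : -(p:ℤ) ≤ x) (h' : x ≤ p) : gammaPQ p 1 x = gammaDisc p x := by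
  rw [nbpq_eq, Equiv.Perm.mul_apply, Equiv.swap_apply_of_ne_of_ne] <;> omega

theorem nbpq_top (p : ℕ) : gammaPQ p 1 ((p:ℤ)+1) = -((p:ℤ)+1) := by
  rw [nbpq_eq, Equiv.Perm.mul_apply, Equiv.swap_apply_left, nbγ_out]
  rw [nb_mem_signed]; omega

theorem nbpq_inB (p : ℕ) : inB (p + 1) (gammaPQ p 1) := by
  rw [nbpq_eq]
  refine nb_inB_mul ⟨(nbγ_inB p).1, fun x hx => (nbγ_inB p).2 x ?_⟩ ?_
  · rw [nb_mem_signed] at hx ⊢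
    push_cast at hx
    omega
  · have : nbOK (p+1) ((p:ℤ)+1) (-((p:ℤ)+1)) := by
      refine ⟨?_, ?_, ?_⟩
      · rw [nb_mem_signed]; push_cast; omega
      · rw [nb_mem_signed]; push_cast; omega
      · omega
    have h := nbg_inB this
    unfold nbg at h
    rwa [if_pos rfl] at h

theorem nbpq_F (p : ℕ) (hp : 1 ≤ p) : nbF (p + 1) (gammaPQ p 1) = ⊥ := by
  rw [eq_bot_iff]
  intro f hf
  refine nb_zero_of_pos hf.1 ?_
  have h1 := nb_const_zero hf.1 hp (fun x h1 h2 => by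
    rw [← hf.2 x, nbpq_lt p x (by omega) h2])
  intro x hx hx'
  by_cases hc : x ≤ p
  · exact h1 x hx hc
  · have : x = (p:ℤ)+1 := by push_cast at hx'; omega
    have h2 := hf.2 x
    rw [this, nbpq_top, hf.1.1] at h2
    rw [this]; linarith

theorem nb_ok_of {n : ℕ} {x y : ℤ} (h : (x ≠ 0 ∧ -(n:ℤ) ≤ x ∧ x ≤ n) ∧ (y ≠ 0 ∧ -(n:ℤ) ≤ y ∧ y ≤ n) ∧ x ≠ y) :
    nbOK n x y := ⟨nb_mem_signed.2 h.1, nb_mem_signed.2 h.2.1, h.2.2⟩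

theorem nb_ok_iff {n : ℕ} {x y : ℤ} : nbOK n x y ↔ (x ≠ 0 ∧ -(n:ℤ) ≤ x ∧ x ≤ n) ∧ (y ≠ 0 ∧ -(n:ℤ) ≤ y ∧ y ≤ n) ∧ x ≠ y := by
  unfold nbOK; rw [nb_mem_signed, nb_mem_signed]

theorem nb_neg_eq {n : ℕ} {f : ℤ → ℝ} (hf : f ∈ nbV n) (x : ℤ) : f (-x) = - f x := (nb_mem_V.1 hf).1 x

theorem nb_Zin {p : ℕ} (hp : 2 ≤ p) (a : ℤ) (ha : 1 ≤ a) (ha' : a ≤ p) :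
    nbH (p+1) ((p:ℤ)+1) (-((p:ℤ)+1)) ⊓ nbH (p+1) a (-a) ∈ nbP (p+1) (gammaPQ p 1) := by
  refine nbP_two (nbpq_inB p) (nbpq_F p (by omega)) (nb_ok_of (by omega))
    (nb_ok_of (by omega)) ?_
  intro f hf h
  have hz := nb_const_zero hf (p := p) (by omega) (fun x h1 h2 => by
    have h3 := h x
    rw [nbpq_lt p x (by omega) h2] at h3
    have hm : gammaDisc p x ∈ signedSet p := nb_inB_mem (nbγ_inB p) (nb_mem_signed.2 (by omega))
    rw [nb_mem_signed] at hm
    rw [nbg_apply (by omega) (by omega) (by omega), if_neg (by omega), if_neg (by omega),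
      if_neg (by omega), if_neg (by omega)] at h3
    exact h3)
  rw [nb_neg_eq hf, hz a ha ha', neg_zero]

theorem nb_Z12 {p : ℕ} (hp : 2 ≤ p) :
    nbH (p+1) 1 (-1) ⊓ nbH (p+1) 1 2 ∈ nbP (p+1) (gammaPQ p 1) := by
  refine nbP_two (nbpq_inB p) (nbpq_F p (by omega)) (nb_ok_of (by omega))
    (nb_ok_of (by omega)) ?_
  intro f hf h
  have h3 := h 1
  rw [nbpq_lt p 1 (by omega) (by omega), nbγ_succ p 1 (by omega) (by omega),
    nbg_apply (by omega) (by omega) (by omega)] at h3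
  norm_num at h3
  exact h3.symm

theorem nb_T {p : ℕ} (hp : 2 ≤ p) (s t : ℤ) (hs : s = 1 ∨ s = -1) (ht : t = 1 ∨ t = -1) :
    ∃ T ∈ nbP (p+1) (gammaPQ p 1), T ≤ nbH (p+1) 1 (s*2) ∧ T ≤ nbH (p+1) 2 (t*((p:ℤ)+1)) ∧
      ¬ T ≤ nbH (p+1) 1 (-1) := by
  have hδ : ∀ c d : ℝ, (nbδ 1 + c • nbδ 2 + d • nbδ ((p:ℤ)+1)) ∈ nbV (p+1) := fun c d =>
    add_mem (add_mem (nbδ_mem (nb_mem_signed.2 (by omega)))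
      (Submodule.smul_mem _ _ (nbδ_mem (nb_mem_signed.2 (by omega)))))
      (Submodule.smul_mem _ _ (nbδ_mem (nb_mem_signed.2 (by omega))))
  have e1 : ∀ c d : ℝ, (nbδ 1 + c • nbδ 2 + d • nbδ ((p:ℤ)+1)) 1 = 1 := fun c d => by
    simp only [Pi.add_apply, Pi.smul_apply, smul_eq_mul, nbδ]
    rw [if_pos True.intro, if_neg (by omega), if_neg (by omega), if_neg (by omega), if_neg (by omega)]; ring
  have e2 : ∀ c d : ℝ, (nbδ 1 + c • nbδ 2 + d • nbδ ((p:ℤ)+1)) 2 = c := fun c d => by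
    simp only [Pi.add_apply, Pi.smul_apply, smul_eq_mul, nbδ]
    rw [if_neg (by omega), if_neg (by omega), if_pos True.intro, if_neg (by omega), if_neg (by omega)]; ring
  have e3 : ∀ c d : ℝ, (nbδ 1 + c • nbδ 2 + d • nbδ ((p:ℤ)+1)) ((p:ℤ)+1) = d := fun c d => by
    simp only [Pi.add_apply, Pi.smul_apply, smul_eq_mul, nbδ]
    rw [if_neg (by omega), if_neg (by omega), if_neg (by omega), if_neg (by omega), if_pos True.intro]; ring
  have okt1 : nbOK (p+1) 1 (t*((p:ℤ)+1)) := nb_ok_of (by rcases ht with rfl | rfl <;> omega)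
  have okt2 : nbOK (p+1) 2 (t*((p:ℤ)+1)) := nb_ok_of (by rcases ht with rfl | rfl <;> omega)
  have hnot : ∀ T : Submodule ℝ (ℤ → ℝ), (∃ c d : ℝ, (nbδ 1 + c • nbδ 2 + d • nbδ ((p:ℤ)+1)) ∈ T) →
      ¬ T ≤ nbH (p+1) 1 (-1) := by
    rintro T ⟨c, d, h⟩ hT
    have := (nb_mem_H.1 (hT h)).2
    rw [nb_neg_eq (hδ c d), e1] at this
    norm_num at this
  rcases hs with rfl | rfl
  · refine ⟨nbH (p+1) 1 (t*((p:ℤ)+1)) ⊓ nbH (p+1) 1 2, ?_, ?_, ?_, hnot _ ⟨1, t, ?_⟩⟩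
    · refine nbP_two (nbpq_inB p) (nbpq_F p (by omega)) okt1 (nb_ok_of (by omega)) ?_
      intro f hf h
      have h3 := h 1
      rw [nbpq_lt p 1 (by omega) (by omega), nbγ_succ p 1 (by omega) (by omega)] at h3
      rw [nbg_apply (by omega) (by rcases ht with rfl | rfl <;> omega) (by rcases ht with rfl | rfl <;> omega),
        if_neg (by omega), if_neg (by rcases ht with rfl | rfl <;> omega), if_neg (by omega),
        if_neg (by rcases ht with rfl | rfl <;> omega)] at h3
      exact h3.symm
    · exact inf_le_right
    · intro f hf
      have h1 := nb_mem_H.1 hf.1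
      have h2 := nb_mem_H.1 hf.2
      exact nb_mem_H.2 ⟨h1.1, h2.2.symm.trans h1.2⟩
    · refine ⟨nb_mem_H.2 ⟨hδ _ _, ?_⟩, nb_mem_H.2 ⟨hδ _ _, ?_⟩⟩
      · rcases ht with rfl | rfl
        · rw [one_mul, e1, e3]; simp
        · rw [neg_one_mul, nb_neg_eq (hδ _ _), e1, e3]; simp
      · rw [e1, e2]
  · refine ⟨nbH (p+1) 2 (t*((p:ℤ)+1)) ⊓ nbH (p+1) 1 (-2), ?_, ?_, ?_, hnot _ ⟨-1, -t, ?_⟩⟩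
    · refine nbP_two (nbpq_inB p) (nbpq_F p (by omega)) okt2 (nb_ok_of (by omega)) ?_
      intro f hf h
      have h3 := h 1
      have h4 := h ((p:ℤ)+1)
      rw [nbpq_top] at h4
      rw [nbpq_lt p 1 (by omega) (by omega), nbγ_succ p 1 (by omega) (by omega)] at h3
      rw [nbg_apply (by omega) (by rcases ht with rfl | rfl <;> omega) (by rcases ht with rfl | rfl <;> omega)] at h3 h4
      rw [if_pos (by norm_num)] at h3
      rw [if_neg (by omega)] at h4
      rcases ht with rfl | rfl
      · rw [if_neg (by omega), if_neg (by omega), if_pos (by ring)] at h4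
        rw [h4, ← h3, one_mul]
      · rw [if_pos (by ring)] at h4
        rw [nb_neg_eq hf, h4, ← h3, neg_one_mul, nb_neg_eq hf]
    · exact inf_le_right
    · exact inf_le_left
    · refine ⟨nb_mem_H.2 ⟨hδ _ _, ?_⟩, nb_mem_H.2 ⟨hδ _ _, ?_⟩⟩
      · rcases ht with rfl | rfl
        · rw [one_mul, e2, e3]; simp
        · rw [neg_one_mul, nb_neg_eq (hδ _ _), e2, e3]; simp
      · rw [nb_neg_eq (hδ _ _), e1, e2]; simp

theorem nb_pre {n : ℕ} {γ σ : Equiv.Perm ℤ} (hγ : inB n γ) (h0 : nbF n γ = ⊥) (hS : nbS n γ σ)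
    {α u : ℤ → ℝ} (hu : u ∈ nbV n) (hα : nbD γ⁻¹ u = α) (ho : ∀ f ∈ nbF n σ, nbip n f α = 0) :
    ∀ x, u (σ⁻¹ (γ x)) = u x := by
  have hαV : α ∈ nbV n := by rw [← hα]; exact nbD_mem (nb_inB_inv hγ) hu
  have hK := nbF_le n (σ⁻¹ * γ)
  have := nb_fin_of_le hK
  have hr := nb_rank_null (nbF n (σ⁻¹ * γ)) (nbD γ⁻¹)
  have hker : nbV n ⊓ LinearMap.ker (nbD γ⁻¹) = ⊥ := by rw [nbD_ker, nbF_inv, h0]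
  have hb : nbF n (σ⁻¹ * γ) ⊓ LinearMap.ker (nbD γ⁻¹) = ⊥ := by
    rw [eq_bot_iff, ← hker]; exact inf_le_inf_right _ hK
  rw [hb, finrank_bot, add_zero] at hr
  have hmem : α ∈ (nbF n (σ⁻¹ * γ)).map (nbD γ⁻¹) := by
    refine nb_orth_mem (n := n) (F := nbF n σ) ?_ (nbF_le n σ) ?_ ?_ hαV ho
    · rintro _ ⟨w, hw, rfl⟩
      exact nbD_mem (nb_inB_inv hγ) (hK hw)
    · rintro f hf _ ⟨w, hw, rfl⟩
      have : nbD γ⁻¹ w = nbD σ⁻¹ w := by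
        rw [nbD_apply, nbD_apply]
        congr 1
        funext x
        have := (nb_mem_F.1 hw).2 (γ⁻¹ x)
        rw [← this]
        simp
      rw [this]
      exact nb_orth_F (nb_inB_inv hS.1) (by rw [nbF_inv]; exact hf)
    · rw [hr, add_comm]; exact hS.2
  obtain ⟨w, hw, hwα⟩ := hmem
  have : w - u ∈ nbV n ⊓ LinearMap.ker (nbD γ⁻¹) := by
    refine ⟨sub_mem (hK hw) hu, ?_⟩
    change w - u ∈ LinearMap.ker (nbD γ⁻¹)
    rw [LinearMap.mem_ker, map_sub, hwα, hα, sub_self]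
  rw [hker, Submodule.mem_bot, sub_eq_zero] at this
  subst this
  exact (nb_mem_F.1 hw).2

noncomputable def nbU (n : ℕ) (i j : ℤ) : ℤ → ℝ := fun x =>
  if (j ≤ x ∧ x ≤ n) ∨ (-(i-1) ≤ x ∧ x ≤ -1) then 1
  else if (-(n:ℤ) ≤ x ∧ x ≤ -j) ∨ (1 ≤ x ∧ x ≤ i - 1) then -1 else 0

theorem nbU_pos {n : ℕ} {i j x : ℤ} (h : (j ≤ x ∧ x ≤ n) ∨ (-(i-1) ≤ x ∧ x ≤ -1)) :
    nbU n i j x = 1 := if_pos h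

theorem nbU_neg {n : ℕ} {i j x : ℤ} (hi : 1 ≤ i) (hij : i < j) (h : (-(n:ℤ) ≤ x ∧ x ≤ -j) ∨ (1 ≤ x ∧ x ≤ i - 1)) :
    nbU n i j x = -1 := by
  unfold nbU
  rw [if_neg (by omega), if_pos h]

theorem nbU_zero {n : ℕ} {i j x : ℤ} (h : ¬ ((j ≤ x ∧ x ≤ n) ∨ (-(i-1) ≤ x ∧ x ≤ -1)))
    (h' : ¬ ((-(n:ℤ) ≤ x ∧ x ≤ -j) ∨ (1 ≤ x ∧ x ≤ i - 1))) :
    nbU n i j x = 0 := by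
  unfold nbU
  rw [if_neg h, if_neg h']

theorem nbU_mem {n : ℕ} {i j : ℤ} (hi : 1 ≤ i) (hij : i < j) (hj : j ≤ n) : nbU n i j ∈ nbV n := by
  rw [nb_mem_V]
  constructor
  · intro x
    by_cases h1 : (j ≤ x ∧ x ≤ n) ∨ (-(i-1) ≤ x ∧ x ≤ -1)
    · rw [nbU_pos h1, nbU_neg hi hij (by omega)]
    by_cases h2 : (-(n:ℤ) ≤ x ∧ x ≤ -j) ∨ (1 ≤ x ∧ x ≤ i - 1)
    · rw [nbU_neg hi hij h2, nbU_pos (by omega)]; ring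
    · rw [nbU_zero h1 h2, nbU_zero (by omega) (by omega)]; ring
  · intro x hx
    rw [nb_mem_signed] at hx
    exact nbU_zero (by omega) (by omega)

theorem nbU_D {n : ℕ} {i j : ℤ} (hi : 1 ≤ i) (hij : i < j) (hj : j ≤ n) :
    nbD (gammaDisc n)⁻¹ (nbU n i j) = nbδ i + nbδ j := by
  have hV := nbU_mem hi hij hj
  rw [← sub_eq_zero]
  refine nb_zero_of_pos (n := n) (sub_mem (nbD_mem (nb_inB_inv (nbγ_inB n)) hV)
    (add_mem (nbδ_mem (nb_mem_signed.2 (by omega))) (nbδ_mem (nb_mem_signed.2 (by omega))))) ?_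
  intro x h1 h2
  rw [nbD_apply]
  simp only [Pi.sub_apply, Pi.add_apply]
  rcases eq_or_lt_of_le h1 with h | h
  · subst h
    have : (gammaDisc n)⁻¹ 1 = -(n:ℤ) := by
      rw [Equiv.Perm.inv_eq_iff_eq, nbγ_ntop n (by omega)]
    rw [this, nbU_neg (x := -(n:ℤ)) hi hij (by omega)]
    rcases eq_or_lt_of_le hi with h | h
    · subst h
      rw [nbU_zero (by omega) (by omega)]
      simp only [nbδ]
      rw [if_pos True.intro, if_neg (by omega), if_neg (by omega)]; ring
    · rw [nbU_neg hi hij (by omega)]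
      simp only [nbδ]
      rw [if_neg (by omega), if_neg (by omega), if_neg (by omega), if_neg (by omega)]; ring
  · have : (gammaDisc n)⁻¹ x = x - 1 := by
      rw [Equiv.Perm.inv_eq_iff_eq, nbγ_succ n (x-1) (by omega) (by omega)]; ring
    rw [this]
    simp only [nbδ]
    rcases lt_trichotomy x i with c | c | c
    · rw [nbU_neg hi hij (by omega), nbU_neg hi hij (by omega),
        if_neg (by omega), if_neg (by omega), if_neg (by omega), if_neg (by omega)]; ring
    · rw [nbU_zero (by omega) (by omega), nbU_neg hi hij (by omega),
        if_pos c, if_neg (by omega), if_neg (by omega)]; ring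
    · rcases lt_trichotomy x j with d | d | d
      · rw [nbU_zero (by omega) (by omega), nbU_zero (by omega) (by omega),
        if_neg (by omega), if_neg (by omega), if_neg (by omega), if_neg (by omega)]; ring
      · rw [nbU_pos (by omega), nbU_zero (by omega) (by omega),
        if_neg (by omega), if_neg (by omega), if_pos d]; ring
      · rw [nbU_pos (by omega), nbU_pos (by omega),
        if_neg (by omega), if_neg (by omega), if_neg (by omega), if_neg (by omega)]; ring

theorem nb_tele (f : ℤ → ℝ) (i : ℤ) (m : ℕ) :
    ∑ x ∈ Finset.Icc i (i + m - 1), f (x+1) - ∑ x ∈ Finset.Icc i (i + m - 1), f x = f (i + m) - f i := by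
  induction m with
  | zero => simp
  | succ m ih =>
    have : Finset.Icc i (i + (m+1:ℕ) - 1) = insert (i + m) (Finset.Icc i (i + m - 1)) := by
      ext x; simp only [Finset.mem_Icc, Finset.mem_insert]; omega
    rw [this, Finset.sum_insert (by simp), Finset.sum_insert (by simp)]
    push_cast
    rw [← add_assoc]
    linarith

theorem nb_cross {n : ℕ} {σ : Equiv.Perm ℤ} (hS : nbS n (gammaDisc n) σ) {i j k : ℤ}
    (hi : 1 ≤ i) (hij : i < j) (hjk : j < k) (hk : k ≤ n)
    (h : ∀ f ∈ nbF n σ, f i = - f j ∧ f j = - f k) : ∀ f ∈ nbF n σ, f i = 0 := by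
  have hγ := nbγ_inB n
  have h0 := nbγ_F n (by omega)
  have hor : ∀ a b : ℤ, 1 ≤ a → a ≤ n → 1 ≤ b → b ≤ n → (∀ f ∈ nbF n σ, f a = - f b) →
      ∀ f ∈ nbF n σ, nbip n f (nbδ a + nbδ b) = 0 := by
    intro a b h1 h2 h3 h4 h5 f hf
    rw [nbip_add, nbip_δ (nbF_le n σ hf) (nb_mem_signed.2 (by omega)),
      nbip_δ (nbF_le n σ hf) (nb_mem_signed.2 (by omega)), h5 f hf]
    ring
  have hu := nb_pre hγ h0 hS (nbU_mem hi hij (by omega)) (nbU_D hi hij (by omega))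
    (hor i j (by omega) (by omega) (by omega) (by omega) (fun f hf => (h f hf).1))
  have hw := nb_pre hγ h0 hS (nbU_mem (by omega) hjk (by omega)) (nbU_D (by omega) hjk (by omega))
    (hor j k (by omega) (by omega) (by omega) (by omega) (fun f hf => (h f hf).2))
  have hM : ∀ x, x ∈ Finset.Icc i (j-1) ↔ (nbU n i j x = 0 ∧ nbU n j k x = -1) := by
    intro x
    rw [Finset.mem_Icc]
    constructor
    · intro hx
      exact ⟨nbU_zero (by omega) (by omega), nbU_neg (by omega) hjk (by omega)⟩
    · rintro ⟨h1, h2⟩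
      have a1 : ¬ ((j ≤ x ∧ x ≤ n) ∨ (-(i-1) ≤ x ∧ x ≤ -1)) := fun c => by
        rw [nbU_pos c] at h1; norm_num at h1
      have a2 : ¬ ((-(n:ℤ) ≤ x ∧ x ≤ -j) ∨ (1 ≤ x ∧ x ≤ i - 1)) := fun c => by
        rw [nbU_neg hi hij c] at h1; norm_num at h1
      have a3 : ¬ ((k ≤ x ∧ x ≤ n) ∨ (-(j-1) ≤ x ∧ x ≤ -1)) := fun c => by
        rw [nbU_pos c] at h2; norm_num at h2
      have a4 : (-(n:ℤ) ≤ x ∧ x ≤ -k) ∨ (1 ≤ x ∧ x ≤ j - 1) := by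
        by_contra c
        rw [nbU_zero a3 c] at h2; norm_num at h2
      omega
  intro f hf
  have hf' := nb_mem_F.1 hf
  have key : ∑ x ∈ Finset.Icc i (j-1), f (x+1) = ∑ x ∈ Finset.Icc i (j-1), f x := by
    refine Finset.sum_equiv (σ⁻¹ * gammaDisc n) ?_ ?_
    · intro x
      rw [hM, hM, Equiv.Perm.mul_apply, hu, hw]
    · intro x hx
      rw [Finset.mem_Icc] at hx
      rw [Equiv.Perm.mul_apply, ← hf'.2 (σ⁻¹ _), nbγ_succ n x (by omega) (by omega)]
      simp
  have ht := nb_tele f i (j - i).toNat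
  rw [show i + ((j - i).toNat : ℤ) = j by omega, key, sub_self] at ht
  have := (h f hf).1
  linarith

theorem nb_bad {n : ℕ} {a b c : ℤ} (ha : 1 ≤ a) (ha' : a ≤ n) (hb : 1 ≤ b) (hb' : b ≤ n)
    (hc : 1 ≤ c) (hc' : c ≤ n) (hab : a ≠ b) (hbc : b ≠ c) (hac : a ≠ c) :
    ∃ s t : ℤ, (s = 1 ∨ s = -1) ∧ (t = 1 ∨ t = -1) ∧ ∀ U ∈ nbP n (gammaDisc n),
      U ≤ nbH n a (s * b) → U ≤ nbH n b (t * c) → U ≤ nbH n a (-a) := by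
  have key : ∀ i j k : ℤ, 1 ≤ i → i < j → j < k → k ≤ n → ∀ σ, nbS n (gammaDisc n) σ →
    (∀ f ∈ nbF n σ, f i = - f j ∧ f j = - f k) → ∀ f ∈ nbF n σ, f i = 0 ∧ f j = 0 ∧ f k = 0 := by
    intro i j k h1 h2 h3 h4 σ hS h f hf
    have := nb_cross hS h1 h2 h3 h4 h f hf
    have h5 := h f hf
    refine ⟨this, ?_, ?_⟩ <;> linarith
  have main : ∃ s t : ℤ, (s = 1 ∨ s = -1) ∧ (t = 1 ∨ t = -1) ∧ ∀ σ, nbS n (gammaDisc n) σ →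
    (∀ f ∈ nbF n σ, f a = s * f b ∧ f b = t * f c) → ∀ f ∈ nbF n σ, f a = 0 := by
    rcases lt_or_gt_of_ne hab with h1 | h1 <;> rcases lt_or_gt_of_ne hbc with h2 | h2 <;>
      rcases lt_or_gt_of_ne hac with h3 | h3
    · refine ⟨-1, -1, by simp, by simp, fun σ hS h f hf => ?_⟩
      exact (key a b c ha h1 h2 hc' σ hS (fun g hg => by have := h g hg; push_cast at this; constructor <;> linarith) f hf).1
    · omega
    · refine ⟨1, -1, by simp, by simp, fun σ hS h f hf => ?_⟩
      exact (key a c b ha h3 h2 hb' σ hS (fun g hg => by have := h g hg; push_cast at this; constructor <;> linarith) f hf).1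
    · refine ⟨-1, 1, by simp, by simp, fun σ hS h f hf => ?_⟩
      exact (key c a b hc h3 h1 hb' σ hS (fun g hg => by have := h g hg; push_cast at this; constructor <;> linarith) f hf).2.1
    · refine ⟨-1, 1, by simp, by simp, fun σ hS h f hf => ?_⟩
      exact (key b a c hb h1 h3 hc' σ hS (fun g hg => by have := h g hg; push_cast at this; constructor <;> linarith) f hf).2.1
    · refine ⟨1, -1, by simp, by simp, fun σ hS h f hf => ?_⟩
      exact (key b c a hb h2 h3 ha' σ hS (fun g hg => by have := h g hg; push_cast at this; constructor <;> linarith) f hf).2.2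
    · omega
    · refine ⟨-1, -1, by simp, by simp, fun σ hS h f hf => ?_⟩
      exact (key c b a hc h2 h1 ha' σ hS (fun g hg => by have := h g hg; push_cast at this; constructor <;> linarith) f hf).2.2
  obtain ⟨s, t, hs, ht, hm⟩ := main
  refine ⟨s, t, hs, ht, ?_⟩
  rintro U ⟨σ, hS, rfl⟩ hA hB f hf
  have hval : ∀ s : ℤ, (s = 1 ∨ s = -1) → ∀ g ∈ nbV n, ∀ y : ℤ, g (s * y) = s * g y := by
    rintro s (rfl | rfl) g hg y
    · simp
    · rw [neg_one_mul, nb_neg_eq hg]; simp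
  have := hm σ hS (fun g hg => ⟨by rw [(nb_mem_H.1 (hA hg)).2, hval s hs g (nbF_le n σ hg)],
    by rw [(nb_mem_H.1 (hB hg)).2, hval t ht g (nbF_le n σ hg)]⟩) f hf
  refine nb_mem_H.2 ⟨nbF_le n σ hf, ?_⟩
  rw [nb_neg_eq (nbF_le n σ hf), this, neg_zero]

theorem nb_orb_iff {τ : Equiv.Perm ℤ} {x y : ℤ} : y ∈ permOrbit τ x ↔ τ.SameCycle x y := Iff.rfl

theorem nb_zpow {n : ℕ} {τ : Equiv.Perm ℤ} (h : inB n τ) (m : ℤ) : inB n (τ ^ m) := by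
  have hnat : ∀ k : ℕ, inB n (τ ^ k) := by
    intro k
    induction k with
    | zero => rw [pow_zero]; exact nb_inB_one n
    | succ k ih => rw [pow_succ]; exact nb_inB_mul ih h
  cases m with
  | ofNat k => simpa using hnat k
  | negSucc k => rw [zpow_negSucc]; exact nb_inB_inv (hnat _)

theorem nb_orb_signed {n : ℕ} {τ : Equiv.Perm ℤ} (h : inB n τ) {x y : ℤ} (hx : x ∈ signedSet n)
    (hy : y ∈ permOrbit τ x) : y ∈ signedSet n := by
  obtain ⟨m, rfl⟩ := hy
  exact nb_inB_mem (nb_zpow h m) hx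

theorem nb_orb_neg {n : ℕ} {τ : Equiv.Perm ℤ} (h : inB n τ) {x y : ℤ} :
    y ∈ permOrbit τ x → -y ∈ permOrbit τ (-x) := by
  rintro ⟨m, rfl⟩
  exact ⟨m, (nb_zpow h m).1 x⟩

theorem nb_orb_negSet {n : ℕ} {τ : Equiv.Perm ℤ} (h : inB n τ) (x : ℤ) :
    negSet (permOrbit τ x) = permOrbit τ (-x) := by
  ext y
  constructor
  · intro hy
    have := nb_orb_neg h (show -y ∈ permOrbit τ x from hy)
    rwa [neg_neg] at this
  · intro hy
    have := nb_orb_neg h hy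
    rw [neg_neg] at this
    exact this

theorem nb_orb_eq {τ : Equiv.Perm ℤ} {x y : ℤ} (h : y ∈ permOrbit τ x) : permOrbit τ y = permOrbit τ x := by
  ext z
  rw [nb_orb_iff, nb_orb_iff]
  rw [nb_orb_iff] at h
  exact ⟨fun h' => h.trans h', fun h' => h.symm.trans h'⟩

theorem nb_orb_self {τ : Equiv.Perm ℤ} {x : ℤ} : x ∈ permOrbit τ x := ⟨0, by simp⟩

theorem nb_inv_iff {n : ℕ} {τ : Equiv.Perm ℤ} (h : inB n τ) (x : ℤ) :
    negSet (permOrbit τ x) = permOrbit τ x ↔ -x ∈ permOrbit τ x := by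
  rw [nb_orb_negSet h]
  constructor
  · intro h; rw [← h]; exact nb_orb_self
  · intro h; exact nb_orb_eq h

theorem nb_orb_const {n : ℕ} {τ : Equiv.Perm ℤ} {f : ℤ → ℝ} (hf : f ∈ nbF n τ) {x y : ℤ}
    (h : y ∈ permOrbit τ x) : f y = f x := by
  obtain ⟨m, rfl⟩ := h
  have hf' := (nb_mem_F.1 hf).2
  have hnat : ∀ k : ℕ, ∀ x, f ((τ ^ k) x) = f x := by
    intro k
    induction k with
    | zero => intro x; simp
    | succ k ih => intro x; rw [pow_succ', Equiv.Perm.mul_apply, hf', ih]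
  cases m with
  | ofNat k => simpa using hnat k x
  | negSucc k =>
    rw [zpow_negSucc]
    have := hnat (k+1) ((τ ^ (k+1))⁻¹ x)
    rw [← this]
    congr 1
    rw [← Equiv.Perm.mul_apply, mul_inv_cancel, Equiv.Perm.one_apply]

theorem nb_orb_zero {n : ℕ} {τ : Equiv.Perm ℤ} {f : ℤ → ℝ} (hf : f ∈ nbF n τ) {x : ℤ}
    (h : -x ∈ permOrbit τ x) : f x = 0 := by
  have := nb_orb_const hf h
  rw [nb_neg_eq (nbF_le n τ hf)] at this
  linarith

open Classical in
noncomputable def nbI (τ : Equiv.Perm ℤ) (x : ℤ) : ℤ → ℝ := fun y =>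
  (if y ∈ permOrbit τ x then 1 else 0) - (if y ∈ permOrbit τ (-x) then 1 else 0)

open Classical in
theorem nbI_mem {n : ℕ} {τ : Equiv.Perm ℤ} (h : inB n τ) {x : ℤ} (hx : x ∈ signedSet n) :
    nbI τ x ∈ nbF n τ := by
  have hx' : -x ∈ signedSet n := by rw [nb_mem_signed] at hx ⊢; omega
  rw [nb_mem_F, nb_mem_V]
  refine ⟨⟨?_, ?_⟩, ?_⟩
  · intro y
    unfold nbI
    have a1 : -y ∈ permOrbit τ x ↔ y ∈ permOrbit τ (-x) :=
      ⟨fun h1 => by simpa using nb_orb_neg h h1, fun h1 => by simpa using nb_orb_neg h h1⟩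
    have a2 : -y ∈ permOrbit τ (-x) ↔ y ∈ permOrbit τ x :=
      ⟨fun h1 => by simpa using nb_orb_neg h h1, fun h1 => by simpa using nb_orb_neg h h1⟩
    rw [if_congr a1 rfl rfl, if_congr a2 rfl rfl]; ring
  · intro y hy
    unfold nbI
    rw [if_neg (fun c => hy (nb_orb_signed h hx c)), if_neg (fun c => hy (nb_orb_signed h hx' c))]
    ring
  · intro y
    unfold nbI
    have a1 : ∀ z, τ y ∈ permOrbit τ z ↔ y ∈ permOrbit τ z := fun z => by
      rw [nb_orb_iff, nb_orb_iff, Equiv.Perm.sameCycle_apply_right]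
    rw [if_congr (a1 x) rfl rfl, if_congr (a1 (-x)) rfl rfl]

theorem nb_sep {n : ℕ} {τ : Equiv.Perm ℤ} (h : inB n τ) {x y : ℤ} (hx : x ∈ signedSet n)
    (hn : -x ∉ permOrbit τ x) (hf : ∀ f ∈ nbF n τ, f y = f x) : y ∈ permOrbit τ x := by
  have h1 := hf _ (nbI_mem h hx)
  have h2 : x ∉ permOrbit τ (-x) := fun c => hn (by rw [nb_orb_eq c]; exact nb_orb_self)
  by_contra c
  unfold nbI at h1
  rw [if_neg c, if_pos nb_orb_self, if_neg h2] at h1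
  split_ifs at h1 <;> norm_num at h1

theorem nb_inv_of {n : ℕ} {τ : Equiv.Perm ℤ} (h : inB n τ) {x : ℤ} (hx : x ∈ signedSet n)
    (hf : ∀ f ∈ nbF n τ, f x = 0) : -x ∈ permOrbit τ x := by
  by_contra c
  have h1 := hf _ (nbI_mem h hx)
  have h2 : x ∉ permOrbit τ (-x) := fun c' => c (by rw [nb_orb_eq c']; exact nb_orb_self)
  unfold nbI at h1
  rw [if_pos nb_orb_self, if_neg h2] at h1
  norm_num at h1

theorem nb_zero_mem {n : ℕ} {σ : Equiv.Perm ℤ} (h : inB n σ) {x : ℤ} :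
    x ∈ ⋃₀ {A | A ∈ orbitsOn n σ ∧ negSet A = A} ↔ x ∈ signedSet n ∧ -x ∈ permOrbit σ x := by
  constructor
  · rintro ⟨_, ⟨⟨z, hz, rfl⟩, hn⟩, hx⟩
    refine ⟨nb_orb_signed h hz hx, ?_⟩
    rw [← nb_orb_eq hx] at hn
    exact (nb_inv_iff h x).1 hn
  · rintro ⟨hx, hn⟩
    exact ⟨_, ⟨⟨x, hx, rfl⟩, (nb_inv_iff h x).2 hn⟩, nb_orb_self⟩

theorem nb_block_const {n : ℕ} {σ : Equiv.Perm ℤ} (h : inB n σ) {B : Set ℤ} (hB : B ∈ omegaTilde n σ)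
    {x y : ℤ} (hx : x ∈ B) (hy : y ∈ B) {f : ℤ → ℝ} (hf : f ∈ nbF n σ) : f x = f y := by
  rcases hB with ⟨⟨z, hz, rfl⟩, -⟩ | ⟨rfl, -⟩
  · rw [nb_orb_const hf hx, nb_orb_const hf hy]
  · rw [nb_zero_mem h] at hx hy
    rw [nb_orb_zero hf hx.2, nb_orb_zero hf hy.2]

theorem nb_block_mem {n : ℕ} {τ : Equiv.Perm ℤ} (h : inB n τ) {x : ℤ} (hx : x ∈ signedSet n) :
    ∃ A ∈ omegaTilde n τ, permOrbit τ x ⊆ A := by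
  by_cases hn : negSet (permOrbit τ x) = permOrbit τ x
  · have hs : permOrbit τ x ⊆ ⋃₀ {A | A ∈ orbitsOn n τ ∧ negSet A = A} :=
      fun y hy => ⟨_, ⟨⟨x, hx, rfl⟩, hn⟩, hy⟩
    exact ⟨_, Or.inr ⟨rfl, ⟨x, hs nb_orb_self⟩⟩, hs⟩
  · exact ⟨_, Or.inl ⟨⟨x, hx, rfl⟩, hn⟩, subset_rfl⟩

theorem nb_trans {n : ℕ} {τ σ : Equiv.Perm ℤ} (h : inB n τ) (h' : inB n σ) :
    refines (omegaTilde n τ) (omegaTilde n σ) ↔ nbF n σ ≤ nbF n τ := by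
  constructor
  · intro hr f hf
    refine nb_mem_F.2 ⟨nbF_le n σ hf, fun x => ?_⟩
    by_cases hx : x ∈ signedSet n
    · obtain ⟨A, hA, hs⟩ := nb_block_mem h hx
      obtain ⟨B, hB, hAB⟩ := hr A hA
      exact nb_block_const h' hB (hAB (hs ⟨1, by simp⟩)) (hAB (hs nb_orb_self)) hf
    · rw [h.2 x hx]
  · intro hle A hA
    rcases hA with ⟨⟨x, hx, rfl⟩, -⟩ | ⟨rfl, ⟨z, hz⟩⟩
    · by_cases hn : -x ∈ permOrbit σ x
      · refine ⟨_, Or.inr ⟨rfl, ⟨x, (nb_zero_mem h').2 ⟨hx, hn⟩⟩⟩, ?_⟩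
        intro y hy
        refine (nb_zero_mem h').2 ⟨nb_orb_signed h hx hy, nb_inv_of h' (nb_orb_signed h hx hy) ?_⟩
        intro f hf
        rw [nb_orb_const (hle hf) hy, nb_orb_zero hf hn]
      · refine ⟨permOrbit σ x, Or.inl ⟨⟨x, hx, rfl⟩, ?_⟩, ?_⟩
        · intro c; exact hn ((nb_inv_iff h' x).1 c)
        · intro y hy
          exact nb_sep h' hx hn (fun f hf => nb_orb_const (hle hf) hy)
    · have hs : ⋃₀ {A | A ∈ orbitsOn n τ ∧ negSet A = A} ⊆ ⋃₀ {A | A ∈ orbitsOn n σ ∧ negSet A = A} := by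
        intro y hy
        rw [nb_zero_mem h] at hy
        exact (nb_zero_mem h').2 ⟨hy.1, nb_inv_of h' hy.1 (fun f hf => nb_orb_zero (hle hf) hy.2)⟩
      exact ⟨_, Or.inr ⟨rfl, ⟨z, hs hz⟩⟩, hs⟩

theorem nb_reduce (p : ℕ) (hp : 1 ≤ p) (f : Set (Set ℤ) → Set (Set ℤ))
    (hb : Set.BijOn f (NCB p 1) (NCBdisc (p+1)))
    (ho : ∀ x ∈ NCB p 1, ∀ y ∈ NCB p 1, (refines x y ↔ refines (f x) (f y))) :
    ∃ Φ : Submodule ℝ (ℤ → ℝ) → Submodule ℝ (ℤ → ℝ),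
      (∀ W ∈ nbP (p+1) (gammaPQ p 1), Φ W ∈ nbP (p+1) (gammaDisc (p+1))) ∧
      (∀ W ∈ nbP (p+1) (gammaPQ p 1), ∀ W' ∈ nbP (p+1) (gammaPQ p 1), (W ≤ W' ↔ Φ W ≤ Φ W')) ∧
      (∀ U ∈ nbP (p+1) (gammaDisc (p+1)), ∃ W ∈ nbP (p+1) (gammaPQ p 1), Φ W = U) := by
  have h1 : ∀ τ, τ ∈ SncB p 1 ↔ nbS (p+1) (gammaPQ p 1) τ := fun τ =>
    nb_leB_iff (nbpq_inB p) (nbpq_F p hp)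
  have h2 : ∀ τ, (inB (p+1) τ ∧ leB (p+1) τ (gammaDisc (p+1))) ↔ nbS (p+1) (gammaDisc (p+1)) τ := fun τ =>
    nb_leB_iff (nbγ_inB _) (nbγ_F _ (by omega))
  have key : ∀ W ∈ nbP (p+1) (gammaPQ p 1), ∃ U τ σ, U = nbF (p+1) σ ∧ nbS (p+1) (gammaPQ p 1) τ ∧ W = nbF (p+1) τ ∧
      nbS (p+1) (gammaDisc (p+1)) σ ∧ f (omegaTilde (p+1) τ) = omegaTilde (p+1) σ := by
    rintro W ⟨τ, hτ, rfl⟩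
    obtain ⟨σ, hσ1, hσ2, hσ⟩ := hb.1 (show omegaTilde (p+1) τ ∈ NCB p 1 from ⟨τ, (h1 τ).2 hτ, rfl⟩)
    exact ⟨_, τ, σ, rfl, hτ, rfl, (h2 σ).1 ⟨hσ1, hσ2⟩, hσ⟩
  choose! Φ T S hU hT hW hS hf using key
  refine ⟨Φ, ?_, ?_, ?_⟩
  · intro W hW'
    exact ⟨_, hS W hW', hU W hW'⟩
  · intro W hw W' hw'
    have e := ho _ ⟨_, (h1 _).2 (hT W' hw'), rfl⟩ _ ⟨_, (h1 _).2 (hT W hw), rfl⟩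
    rw [hf W hw, hf W' hw', nb_trans (hT W' hw').1 (hT W hw).1, nb_trans (hS W' hw').1 (hS W hw).1,
      ← hU W hw, ← hU W' hw', ← hW W hw, ← hW W' hw'] at e
    exact e
  · rintro U ⟨σ, hσ, rfl⟩
    obtain ⟨x, ⟨τ, hτ, rfl⟩, hx⟩ := hb.2.2 (show omegaTilde (p+1) σ ∈ NCBdisc (p+1) from
      ⟨σ, ((h2 σ).2 hσ).1, ((h2 σ).2 hσ).2, rfl⟩)
    have hτ' := (h1 τ).1 hτ
    refine ⟨nbF (p+1) τ, ⟨τ, hτ', rfl⟩, ?_⟩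
    have hw : nbF (p+1) τ ∈ nbP (p+1) (gammaPQ p 1) := ⟨τ, hτ', rfl⟩
    have m1 : omegaTilde (p+1) τ ∈ NCB p 1 := ⟨τ, hτ, rfl⟩
    have m2 : omegaTilde (p+1) (T (nbF (p+1) τ)) ∈ NCB p 1 := ⟨_, (h1 _).2 (hT _ hw), rfl⟩
    have e1 := (ho _ m1 _ m2).1 ((nb_trans hτ'.1 (hT _ hw).1).2 (hW _ hw).symm.le)
    have e2 := (ho _ m2 _ m1).1 ((nb_trans (hT _ hw).1 hτ'.1).2 (hW _ hw).le)
    rw [hx, hf _ hw] at e1 e2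
    rw [nb_trans hσ.1 (hS _ hw).1] at e1
    rw [nb_trans (hS _ hw).1 hσ.1] at e2
    rw [hU _ hw]
    exact le_antisymm e1 e2

theorem nbδ_self (k : ℤ) : nbδ k k = 1 := if_pos rfl

theorem nbδ_off {k g : ℤ} (h : g ≠ k) (h' : g ≠ -k) : nbδ k g = 0 := by
  unfold nbδ; rw [if_neg h, if_neg h']

theorem nbδ_one {k g : ℤ} (h : nbδ k g = 1) : g = k := by
  unfold nbδ at h
  split_ifs at h with h1 h2
  · exact h1
  · norm_num at h
  · norm_num at h

theorem nbδ_negv {k : ℤ} (hk : k ≠ 0) : nbδ k (-k) = -1 := by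
  unfold nbδ; rw [if_neg (by omega), if_pos rfl]

theorem nbH_comm (n : ℕ) (x y : ℤ) : nbH n x y = nbH n y x := by
  ext f; rw [nb_mem_H, nb_mem_H]; exact ⟨fun h => ⟨h.1, h.2.symm⟩, fun h => ⟨h.1, h.2.symm⟩⟩

theorem nbH_neg (n : ℕ) (x y : ℤ) : nbH n (-x) (-y) = nbH n x y := by
  ext f; rw [nb_mem_H, nb_mem_H]
  constructor
  · rintro ⟨h, h'⟩
    rw [nb_neg_eq h, nb_neg_eq h] at h'
    exact ⟨h, neg_injective h'⟩
  · rintro ⟨h, h'⟩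
    rw [nb_neg_eq h, nb_neg_eq h, h']
    exact ⟨h, rfl⟩

theorem nbH_neg2 (n : ℕ) (x y : ℤ) : nbH n (-x) y = nbH n x (-y) := by
  have := nbH_neg n x (-y)
  rwa [neg_neg] at this

theorem nbOK_comm {n : ℕ} {x y : ℤ} (h : nbOK n x y) : nbOK n y x := ⟨h.2.1, h.1, h.2.2.symm⟩

theorem nbOK_neg {n : ℕ} {x y : ℤ} (h : nbOK n x y) : nbOK n (-x) (-y) := by
  rw [nb_ok_iff] at h ⊢; omega

theorem nbH_lt {n : ℕ} {x y : ℤ} (h : nbOK n x y) : nbH n x y < nbV n := by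
  refine lt_of_le_of_ne (nbH_le n x y) (fun c => ?_)
  have h1 : nbδ x ∈ nbH n x y := by rw [c]; exact nbδ_mem h.1
  have h2 := (nb_mem_H.1 h1).2
  rw [nbδ_self] at h2
  exact h.2.2 (nbδ_one h2.symm).symm

theorem nbH_rk {n : ℕ} {x y : ℤ} (h : nbOK n x y) : Module.finrank ℝ (nbH n x y) + 1 = nbN n := by
  have h1 := nb_lt_rank le_rfl (nbH_lt h)
  have h2 := nbH_finrank n x y
  have h3 : nbN n = Module.finrank ℝ (nbV n) := rfl
  omega

theorem nb_two_eq {n : ℕ} {x y a b : ℤ} (h : nbOK n x y) (h' : nbOK n a b) (hne : nbH n x y ≠ nbH n a b)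
    {U : Submodule ℝ (ℤ → ℝ)} (hr : nbN n ≤ Module.finrank ℝ U + 2) (h1 : U ≤ nbH n x y)
    (h2 : U ≤ nbH n a b) : U = nbH n x y ⊓ nbH n a b := by
  refine nb_eq_rank (n := n) (inf_le_left.trans (nbH_le n x y)) (le_inf h1 h2) ?_
  have hlt : nbH n x y ⊓ nbH n a b < nbH n x y := by
    refine lt_of_le_of_ne inf_le_left (fun c => hne ?_)
    rw [inf_eq_left] at c
    refine nb_eq_rank (nbH_le n a b) c ?_
    have := nbH_rk h; have := nbH_rk h'; omega
  have := nb_lt_rank (nbH_le n x y) hlt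
  have := nbH_rk h
  omega

theorem nb_comb3 {α : Type*} (H : ℤ → ℤ → α) (hc : ∀ a b, H a b = H b a)
    (hm : ∀ a b, H (-a) (-b) = H a b) (T : ℤ → ℝ) (hT : ∀ z, T (-z) = - T z) {x y w e g : ℤ}
    (vx : T x = 1) (vy : T y = 1) (vw : T w = 1) (hTe : T e = T g) (hn : e ≠ g)
    (he : e = x ∨ e = -x ∨ e = y ∨ e = -y ∨ e = w ∨ e = -w)
    (hg : g = x ∨ g = -x ∨ g = y ∨ g = -y ∨ g = w ∨ g = -w) :
    H e g = H x y ∨ H e g = H x w ∨ H e g = H y w := by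
  rcases he with rfl | rfl | rfl | rfl | rfl | rfl <;> rcases hg with rfl | rfl | rfl | rfl | rfl | rfl <;>
    first
    | exact absurd rfl hn
    | (exfalso; simp only [hT, vx, vy, vw] at hTe; norm_num at hTe; done)
    | (rw [hm]; first
      | exact Or.inl rfl
      | exact Or.inl (hc _ _)
      | exact Or.inr (Or.inl rfl)
      | exact Or.inr (Or.inl (hc _ _))
      | exact Or.inr (Or.inr rfl)
      | exact Or.inr (Or.inr (hc _ _)))
    | exact Or.inl rfl
    | exact Or.inl (hc _ _)
    | exact Or.inr (Or.inl rfl)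
    | exact Or.inr (Or.inl (hc _ _))
    | exact Or.inr (Or.inr rfl)
    | exact Or.inr (Or.inr (hc _ _))

theorem nb_comb2 {α : Type*} (H : ℤ → ℤ → α) (hc : ∀ a b, H a b = H b a)
    (T : ℤ → ℝ) (hT : ∀ z, T (-z) = - T z) {x y c e g : ℤ} (hm : ∀ a b, H (-a) (-b) = H a b)
    (vx : T x = 1) (vy : T y = 1) (vc : T c = 0) (hTe : T e = T g) (hn : e ≠ g)
    (he : e = x ∨ e = -x ∨ e = y ∨ e = -y ∨ e = c ∨ e = -c)
    (hg : g = x ∨ g = -x ∨ g = y ∨ g = -y ∨ g = c ∨ g = -c) :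
    H e g = H x y ∨ H e g = H c (-c) := by
  rcases he with rfl | rfl | rfl | rfl | rfl | rfl <;> rcases hg with rfl | rfl | rfl | rfl | rfl | rfl <;>
    first
    | exact absurd rfl hn
    | (exfalso; simp only [hT, vx, vy, vc] at hTe; norm_num at hTe; done)
    | (rw [hm]; first
      | exact Or.inl rfl
      | exact Or.inl (hc _ _))
    | exact Or.inl rfl
    | exact Or.inl (hc _ _)
    | exact Or.inr rfl
    | exact Or.inr (hc _ _)

theorem nb_comb4 {α : Type*} (H : ℤ → ℤ → α) (hc : ∀ a b, H a b = H b a)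
    (hm : ∀ a b, H (-a) (-b) = H a b) (T S : ℤ → ℝ) (hT : ∀ z, T (-z) = - T z)
    (hS : ∀ z, S (-z) = - S z) {x y c d e g : ℤ}
    (vx : T x = 1) (vy : T y = 1) (vc : T c = 0) (vd : T d = 0)
    (sx : S x = 0) (sy : S y = 0) (sc : S c = 1) (sd : S d = 1)
    (hTe : T e = T g) (hSe : S e = S g) (hn : e ≠ g)
    (he : e = x ∨ e = -x ∨ e = y ∨ e = -y ∨ e = c ∨ e = -c ∨ e = d ∨ e = -d)
    (hg : g = x ∨ g = -x ∨ g = y ∨ g = -y ∨ g = c ∨ g = -c ∨ g = d ∨ g = -d) :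
    H e g = H x y ∨ H e g = H c d := by
  rcases he with rfl | rfl | rfl | rfl | rfl | rfl | rfl | rfl <;>
  rcases hg with rfl | rfl | rfl | rfl | rfl | rfl | rfl | rfl <;>
    first
    | exact absurd rfl hn
    | (exfalso; simp only [hT, vx, vy, vc, vd] at hTe; norm_num at hTe; done)
    | (exfalso; simp only [hS, sx, sy, sc, sd] at hSe; norm_num at hSe; done)
    | (rw [hm]; first
      | exact Or.inl rfl
      | exact Or.inl (hc _ _)
      | exact Or.inr rfl
      | exact Or.inr (hc _ _))
    | exact Or.inl rfl
    | exact Or.inl (hc _ _)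
    | exact Or.inr rfl
    | exact Or.inr (hc _ _)

theorem nb_share {n : ℕ} {x y w e g : ℤ} (hx : x ∈ signedSet n) (hy : y ∈ signedSet n)
    (hw : w ∈ signedSet n) (h1 : x ≠ y) (h2 : x ≠ -y) (h3 : w ≠ x) (h4 : w ≠ -x) (h5 : w ≠ y)
    (h6 : w ≠ -y) (ok : nbOK n e g) (hle : nbH n x y ⊓ nbH n x w ≤ nbH n e g) :
    nbH n e g = nbH n x y ∨ nbH n e g = nbH n x w ∨ nbH n e g = nbH n y w := by
  have ht : ∀ k ∈ signedSet n, k ≠ x → k ≠ -x → k ≠ y → k ≠ -y → k ≠ w → k ≠ -w → nbδ k e = nbδ k g := by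
    intro k hk a1 a2 a3 a4 a5 a6
    refine (nb_mem_H.1 (hle (x := nbδ k) ⟨nb_mem_H.2 ⟨nbδ_mem hk, ?_⟩, nb_mem_H.2 ⟨nbδ_mem hk, ?_⟩⟩)).2
    · rw [nbδ_off (by omega) (by omega), nbδ_off (by omega) (by omega)]
    · rw [nbδ_off (by omega) (by omega), nbδ_off (by omega) (by omega)]
  have hT : (nbδ x + nbδ y + nbδ w) ∈ nbV n := add_mem (add_mem (nbδ_mem hx) (nbδ_mem hy)) (nbδ_mem hw)
  have vx : (nbδ x + nbδ y + nbδ w) x = 1 := by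
    simp only [Pi.add_apply]
    rw [nbδ_self, nbδ_off (by omega) (by omega), nbδ_off (by omega) (by omega)]; ring
  have vy : (nbδ x + nbδ y + nbδ w) y = 1 := by
    simp only [Pi.add_apply]
    rw [nbδ_self, nbδ_off (by omega) (by omega), nbδ_off (by omega) (by omega)]; ring
  have vw : (nbδ x + nbδ y + nbδ w) w = 1 := by
    simp only [Pi.add_apply]
    rw [nbδ_self, nbδ_off (by omega) (by omega), nbδ_off (by omega) (by omega)]; ring
  have hTe : (nbδ x + nbδ y + nbδ w) e = (nbδ x + nbδ y + nbδ w) g :=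
    (nb_mem_H.1 (hle ⟨nb_mem_H.2 ⟨hT, by rw [vx, vy]⟩, nb_mem_H.2 ⟨hT, by rw [vx, vw]⟩⟩)).2
  have he : e = x ∨ e = -x ∨ e = y ∨ e = -y ∨ e = w ∨ e = -w := by
    by_contra c
    push Not at c
    have := ht e ok.1 c.1 c.2.1 c.2.2.1 c.2.2.2.1 c.2.2.2.2.1 c.2.2.2.2.2
    rw [nbδ_self] at this
    exact ok.2.2 (nbδ_one this.symm).symm
  have hg : g = x ∨ g = -x ∨ g = y ∨ g = -y ∨ g = w ∨ g = -w := by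
    by_contra c
    push Not at c
    have := ht g ok.2.1 c.1 c.2.1 c.2.2.1 c.2.2.2.1 c.2.2.2.2.1 c.2.2.2.2.2
    rw [nbδ_self] at this
    exact ok.2.2 (nbδ_one this)
  exact nb_comb3 (nbH n) (nbH_comm n) (nbH_neg n) _ (nb_neg_eq hT) vx vy vw hTe ok.2.2 he hg

theorem nb_disj {n : ℕ} {x y c d e g : ℤ} (ok0 : nbOK n x y) (h2 : y ≠ -x) (ok1 : nbOK n c d)
    (h3 : c ≠ x) (h4 : c ≠ -x) (h5 : c ≠ y) (h6 : c ≠ -y)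
    (h7 : d ≠ x) (h8 : d ≠ -x) (h9 : d ≠ y) (h10 : d ≠ -y)
    (ok : nbOK n e g) (hle : nbH n x y ⊓ nbH n c d ≤ nbH n e g) :
    nbH n e g = nbH n x y ∨ nbH n e g = nbH n c d := by
  have hx0 : x ≠ 0 := (nb_mem_signed.1 ok0.1).1
  have hy0 : y ≠ 0 := (nb_mem_signed.1 ok0.2.1).1
  have hc0 : c ≠ 0 := (nb_mem_signed.1 ok1.1).1
  have hd0 : d ≠ 0 := (nb_mem_signed.1 ok1.2.1).1
  have hxy := ok0.2.2
  have hcd := ok1.2.2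
  have ht : ∀ k ∈ signedSet n, k ≠ x → k ≠ -x → k ≠ y → k ≠ -y → k ≠ c → k ≠ -c → k ≠ d → k ≠ -d →
      nbδ k e = nbδ k g := by
    intro k hk a1 a2 a3 a4 a5 a6 a7 a8
    refine (nb_mem_H.1 (hle (x := nbδ k) ⟨nb_mem_H.2 ⟨nbδ_mem hk, ?_⟩, nb_mem_H.2 ⟨nbδ_mem hk, ?_⟩⟩)).2
    · rw [nbδ_off (by omega) (by omega), nbδ_off (by omega) (by omega)]
    · rw [nbδ_off (by omega) (by omega), nbδ_off (by omega) (by omega)]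
  have hT : (nbδ x + nbδ y) ∈ nbV n := add_mem (nbδ_mem ok0.1) (nbδ_mem ok0.2.1)
  have vx : (nbδ x + nbδ y) x = 1 := by
    simp only [Pi.add_apply]
    rw [nbδ_self, nbδ_off (by omega) (by omega)]; ring
  have vy : (nbδ x + nbδ y) y = 1 := by
    simp only [Pi.add_apply]
    rw [nbδ_self, nbδ_off (by omega) (by omega)]; ring
  have vc : (nbδ x + nbδ y) c = 0 := by
    simp only [Pi.add_apply]
    rw [nbδ_off (by omega) (by omega), nbδ_off (by omega) (by omega)]; ring
  have vd : (nbδ x + nbδ y) d = 0 := by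
    simp only [Pi.add_apply]
    rw [nbδ_off (by omega) (by omega), nbδ_off (by omega) (by omega)]; ring
  have hTe : (nbδ x + nbδ y) e = (nbδ x + nbδ y) g :=
    (nb_mem_H.1 (hle ⟨nb_mem_H.2 ⟨hT, by rw [vx, vy]⟩, nb_mem_H.2 ⟨hT, by rw [vc, vd]⟩⟩)).2
  have sx : (nbδ c + nbδ d) x = 0 := by
    simp only [Pi.add_apply]
    rw [nbδ_off (by omega) (by omega), nbδ_off (by omega) (by omega)]; ring
  have sy : (nbδ c + nbδ d) y = 0 := by
    simp only [Pi.add_apply]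
    rw [nbδ_off (by omega) (by omega), nbδ_off (by omega) (by omega)]; ring
  have sc' : d ≠ -c → (nbδ c + nbδ d) c = 1 := by
    intro hdc
    simp only [Pi.add_apply]
    rw [nbδ_self, nbδ_off (by omega) (by omega)]; ring
  have sd' : d ≠ -c → (nbδ c + nbδ d) d = 1 := by
    intro hdc
    simp only [Pi.add_apply]
    rw [nbδ_self, nbδ_off (by omega) (by omega)]; ring
  have he : e = x ∨ e = -x ∨ e = y ∨ e = -y ∨ e = c ∨ e = -c ∨ e = d ∨ e = -d := by
    by_contra c
    push Not at c
    have := ht e ok.1 c.1 c.2.1 c.2.2.1 c.2.2.2.1 c.2.2.2.2.1 c.2.2.2.2.2.1 c.2.2.2.2.2.2.1 c.2.2.2.2.2.2.2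
    rw [nbδ_self] at this
    exact ok.2.2 (nbδ_one this.symm).symm
  have hg : g = x ∨ g = -x ∨ g = y ∨ g = -y ∨ g = c ∨ g = -c ∨ g = d ∨ g = -d := by
    by_contra c
    push Not at c
    have := ht g ok.2.1 c.1 c.2.1 c.2.2.1 c.2.2.2.1 c.2.2.2.2.1 c.2.2.2.2.2.1 c.2.2.2.2.2.2.1 c.2.2.2.2.2.2.2
    rw [nbδ_self] at this
    exact ok.2.2 (nbδ_one this)
  have hn := ok.2.2
  by_cases hdc : d = -c
  · subst hdc
    rw [neg_neg] at he hg
    have he' : e = x ∨ e = -x ∨ e = y ∨ e = -y ∨ e = c ∨ e = -c := by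
      rcases he with h | h | h | h | h | h | h | h
      exacts [Or.inl h, Or.inr <| Or.inl h, Or.inr <| Or.inr <| Or.inl h, Or.inr <| Or.inr <| Or.inr <| Or.inl h, Or.inr <| Or.inr <| Or.inr <| Or.inr <| Or.inl h, Or.inr <| Or.inr <| Or.inr <| Or.inr <| Or.inr h, Or.inr <| Or.inr <| Or.inr <| Or.inr <| Or.inr h, Or.inr <| Or.inr <| Or.inr <| Or.inr <| Or.inl h]
    have hg' : g = x ∨ g = -x ∨ g = y ∨ g = -y ∨ g = c ∨ g = -c := by
      rcases hg with h | h | h | h | h | h | h | h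
      exacts [Or.inl h, Or.inr <| Or.inl h, Or.inr <| Or.inr <| Or.inl h, Or.inr <| Or.inr <| Or.inr <| Or.inl h, Or.inr <| Or.inr <| Or.inr <| Or.inr <| Or.inl h, Or.inr <| Or.inr <| Or.inr <| Or.inr <| Or.inr h, Or.inr <| Or.inr <| Or.inr <| Or.inr <| Or.inr h, Or.inr <| Or.inr <| Or.inr <| Or.inr <| Or.inl h]
    exact nb_comb2 (nbH n) (nbH_comm n) _ (nb_neg_eq hT) (nbH_neg n) vx vy vc hTe hn he' hg'
  · have hS : (nbδ c + nbδ d) ∈ nbV n := add_mem (nbδ_mem ok1.1) (nbδ_mem ok1.2.1)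
    have sc := sc' hdc
    have sd := sd' hdc
    have hSe : (nbδ c + nbδ d) e = (nbδ c + nbδ d) g :=
      (nb_mem_H.1 (hle ⟨nb_mem_H.2 ⟨hS, by rw [sx, sy]⟩, nb_mem_H.2 ⟨hS, by rw [sc, sd]⟩⟩)).2
    exact nb_comb4 (nbH n) (nbH_comm n) (nbH_neg n) _ _ (nb_neg_eq hT) (nb_neg_eq hS) vx vy vc vd
      sx sy sc sd hTe hSe hn he hg

def nbRoot (n : ℕ) (R : Submodule ℝ (ℤ → ℝ)) : Prop := ∃ a b, nbOK n a b ∧ R = nbH n a b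

theorem nb_four {n : ℕ} {x y : ℤ} {U R1 R2 R3 : Submodule ℝ (ℤ → ℝ)} (hU : U ≤ nbV n)
    (hr : nbN n ≤ Module.finrank ℝ U + 2) (ok0 : nbOK n x y) (hne : y ≠ -x) (h0 : U ≤ nbH n x y)
    (r1 : nbRoot n R1) (r2 : nbRoot n R2) (r3 : nbRoot n R3) (h1 : U ≤ R1) (h2 : U ≤ R2) (h3 : U ≤ R3)
    (d1 : R1 ≠ nbH n x y) (d2 : R2 ≠ nbH n x y) (d3 : R3 ≠ nbH n x y) (d12 : R1 ≠ R2) (d13 : R1 ≠ R3)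
    (d23 : R2 ≠ R3) : ∀ f ∈ U, f x = 0 := by
  by_contra hcon
  push Not at hcon
  obtain ⟨f0, hf0, hfx⟩ := hcon
  have hV := hU hf0
  have hfy : f0 x = f0 y := (nb_mem_H.1 (h0 hf0)).2
  suffices key : ∃ A B, ∀ R, nbRoot n R → U ≤ R → R = nbH n x y ∨ R = A ∨ R = B by
    obtain ⟨A, B, hk⟩ := key
    rcases hk R1 r1 h1 with c1 | c1 | c1
    · exact d1 c1
    all_goals
      rcases hk R2 r2 h2 with c2 | c2 | c2
      · exact d2 c2
      all_goals
        rcases hk R3 r3 h3 with c3 | c3 | c3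
        · exact d3 c3
        all_goals
          first
          | exact d12 (c1.trans c2.symm)
          | exact d13 (c1.trans c3.symm)
          | exact d23 (c2.trans c3.symm)
  have claim : ∀ c d, nbOK n c d → nbH n c d ≠ nbH n x y → U ≤ nbH n c d → (c = x ∨ c = y) →
      ∃ A B, ∀ R, nbRoot n R → U ≤ R → R = nbH n x y ∨ R = A ∨ R = B := by
    intro c d ok hd hle hc
    have hcd : f0 c = f0 d := (nb_mem_H.1 (hle hf0)).2
    have hUeq := nb_two_eq ok0 ok hd.symm hr h0 hle
    have hfc : f0 c = f0 x := by rcases hc with rfl | rfl <;> simp [hfy]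
    have e1 : d ≠ -x := by
      rintro rfl
      rw [nb_neg_eq hV, hfc] at hcd
      exact hfx (by linarith)
    have e2 : d ≠ -y := by
      rintro rfl
      rw [nb_neg_eq hV, hfc, ← hfy] at hcd
      exact hfx (by linarith)
    have e3 : d ≠ x := by
      rintro rfl
      rcases hc with rfl | rfl
      · exact ok.2.2 rfl
      · exact hd (nbH_comm _ _ _)
    have e4 : d ≠ y := by
      rintro rfl
      rcases hc with rfl | rfl
      · exact hd rfl
      · exact ok.2.2 rfl
    have hsub : nbH n x y ⊓ nbH n x d ≤ U := by
      rw [hUeq]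
      intro f hf
      refine ⟨hf.1, ?_⟩
      have a1 := nb_mem_H.1 hf.1
      have a2 := nb_mem_H.1 hf.2
      refine nb_mem_H.2 ⟨a1.1, ?_⟩
      rcases hc with rfl | rfl
      · exact a2.2
      · exact a1.2.symm.trans a2.2
    refine ⟨nbH n x d, nbH n y d, ?_⟩
    rintro R ⟨e, g, oke, rfl⟩ hR
    exact nb_share ok0.1 ok0.2.1 ok.2.1 ok0.2.2 (by omega) e3 e1 e4 e2 oke (hsub.trans hR)
  obtain ⟨c, d, ok, rfl⟩ := r1
  by_cases k1 : c = x ∨ c = y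
  · exact claim c d ok d1 h1 k1
  by_cases k2 : d = x ∨ d = y
  · exact claim d c (nbOK_comm ok) (by rw [nbH_comm]; exact d1) (by rw [nbH_comm]; exact h1) k2
  by_cases k3 : -c = x ∨ -c = y
  · exact claim (-c) (-d) (nbOK_neg ok) (by rw [nbH_neg]; exact d1) (by rw [nbH_neg]; exact h1) k3
  by_cases k4 : -d = x ∨ -d = y
  · exact claim (-d) (-c) (nbOK_neg (nbOK_comm ok)) (by rw [nbH_neg, nbH_comm]; exact d1)
      (by rw [nbH_neg, nbH_comm]; exact h1) k4
  refine ⟨nbH n c d, nbH n c d, ?_⟩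
  rintro R ⟨e, g, oke, rfl⟩ hR
  have hUeq := nb_two_eq ok0 ok d1.symm hr h0 h1
  rcases nb_disj ok0 hne ok (by omega) (by omega) (by omega) (by omega) (by omega) (by omega) (by omega)
    (by omega) oke (hUeq.symm.le.trans hR) with h | h
  · exact Or.inl h
  · exact Or.inr (Or.inl h)

def nbZ (n : ℕ) (x y : ℤ) : Submodule ℝ (ℤ → ℝ) := nbH n x (-x) ⊓ nbH n y (-y)

theorem nb_mem_z {n : ℕ} {x : ℤ} {f : ℤ → ℝ} : f ∈ nbH n x (-x) ↔ f ∈ nbV n ∧ f x = 0 := by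
  rw [nb_mem_H]
  constructor
  · rintro ⟨h, h'⟩
    rw [nb_neg_eq h] at h'
    exact ⟨h, by linarith⟩
  · rintro ⟨h, h'⟩
    rw [nb_neg_eq h, h', neg_zero]
    exact ⟨h, rfl⟩

theorem nb_mem_Z {n : ℕ} {x y : ℤ} {f : ℤ → ℝ} : f ∈ nbZ n x y ↔ f ∈ nbV n ∧ f x = 0 ∧ f y = 0 := by
  unfold nbZ
  rw [Submodule.mem_inf, nb_mem_z, nb_mem_z]
  tauto

theorem nb_okz {n : ℕ} {x : ℤ} (h : x ∈ signedSet n) : nbOK n x (-x) := by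
  rw [nb_mem_signed] at h; rw [nb_ok_iff]; omega

theorem nb_oks {n : ℕ} {x y s : ℤ} (hs : s = 1 ∨ s = -1) (h : x ∈ signedSet n) (h' : y ∈ signedSet n)
    (h1 : x ≠ y) (h2 : x ≠ -y) : nbOK n x (s * y) := by
  rw [nb_mem_signed] at h h'; rw [nb_ok_iff]
  rcases hs with rfl | rfl <;> omega

theorem nb_sval {n : ℕ} {s : ℤ} (hs : s = 1 ∨ s = -1) {g : ℤ → ℝ} (hg : g ∈ nbV n) (y : ℤ) :
    g (s * y) = s * g y := by
  rcases hs with rfl | rfl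
  · simp
  · rw [neg_one_mul, nb_neg_eq hg]; simp

theorem nb_ne1 {n : ℕ} {x y : ℤ} (h' : y ∈ signedSet n) (h1 : x ≠ y) (h2 : x ≠ -y) :
    nbH n x (-x) ≠ nbH n y (-y) := by
  intro c
  have h3 : nbδ y ∈ nbH n x (-x) := nb_mem_z.2 ⟨nbδ_mem h', nbδ_off h1 h2⟩
  rw [c, nb_mem_z, nbδ_self] at h3
  exact one_ne_zero h3.2

theorem nb_ne2 {n : ℕ} {x y s : ℤ} (hs : s = 1 ∨ s = -1) (h' : y ∈ signedSet n)
    (h1 : x ≠ y) (h2 : x ≠ -y) : nbH n x (-x) ≠ nbH n x (s * y) := by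
  intro c
  have h3 : nbδ y ∈ nbH n x (-x) := nb_mem_z.2 ⟨nbδ_mem h', nbδ_off h1 h2⟩
  rw [c, nb_mem_H, nb_sval hs h3.1, nbδ_self, nbδ_off h1 h2] at h3
  rcases hs with rfl | rfl <;> norm_num at h3

theorem nb_ne3 {n : ℕ} {x y s : ℤ} (hs : s = 1 ∨ s = -1) (h : x ∈ signedSet n)
    (h1 : x ≠ y) (h2 : x ≠ -y) : nbH n y (-y) ≠ nbH n x (s * y) := by
  intro c
  have e : nbδ x y = 0 := nbδ_off (by omega) (by omega)
  have h3 : nbδ x ∈ nbH n y (-y) := nb_mem_z.2 ⟨nbδ_mem h, e⟩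
  rw [c, nb_mem_H, nb_sval hs h3.1, nbδ_self, e] at h3
  norm_num at h3

theorem nb_ne4 {n : ℕ} {x y : ℤ} (h : x ∈ signedSet n) (h' : y ∈ signedSet n)
    (h1 : x ≠ y) (h2 : x ≠ -y) : nbH n x y ≠ nbH n x (-y) := by
  intro c
  have hV : nbδ x + nbδ y ∈ nbV n := add_mem (nbδ_mem h) (nbδ_mem h')
  have vx : (nbδ x + nbδ y) x = 1 := by
    simp only [Pi.add_apply]
    rw [nbδ_self, nbδ_off h1 h2]; ring
  have vy : (nbδ x + nbδ y) y = 1 := by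
    simp only [Pi.add_apply]
    rw [nbδ_self, nbδ_off (by omega) (by omega)]; ring
  have h3 : nbδ x + nbδ y ∈ nbH n x y := nb_mem_H.2 ⟨hV, by rw [vx, vy]⟩
  rw [c, nb_mem_H, nb_neg_eq hV, vx, vy] at h3
  norm_num at h3

theorem nb_combZ {α : Type*} (H : ℤ → ℤ → α) (hc : ∀ a b, H a b = H b a)
    (hm : ∀ a b, H (-a) (-b) = H a b) (hm2 : ∀ a b, H (-a) b = H a (-b)) {x y e g : ℤ} (hn : e ≠ g)
    (he : e = x ∨ e = -x ∨ e = y ∨ e = -y)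
    (hg : g = x ∨ g = -x ∨ g = y ∨ g = -y) :
    H e g = H x (-x) ∨ H e g = H y (-y) ∨ H e g = H x y ∨ H e g = H x (-y) := by
  rcases he with rfl | rfl | rfl | rfl <;> rcases hg with rfl | rfl | rfl | rfl
  · exact absurd rfl hn
  · exact Or.inl rfl
  · exact Or.inr (Or.inr (Or.inl rfl))
  · exact Or.inr (Or.inr (Or.inr rfl))
  · exact Or.inl (hc _ _)
  · exact absurd rfl hn
  · exact Or.inr (Or.inr (Or.inr (hm2 _ _)))
  · exact Or.inr (Or.inr (Or.inl (hm _ _)))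
  · exact Or.inr (Or.inr (Or.inl (hc _ _)))
  · exact Or.inr (Or.inr (Or.inr ((hc _ _).trans (hm2 _ _))))
  · exact absurd rfl hn
  · exact Or.inr (Or.inl rfl)
  · exact Or.inr (Or.inr (Or.inr (hc _ _)))
  · exact Or.inr (Or.inr (Or.inl ((hm _ _).trans (hc _ _))))
  · exact Or.inr (Or.inl (hc _ _))
  · exact absurd rfl hn

theorem nb_Zroot {n : ℕ} {x y e g : ℤ} (ok : nbOK n e g) (hle : nbZ n x y ≤ nbH n e g) :
    nbH n e g = nbH n x (-x) ∨ nbH n e g = nbH n y (-y) ∨ nbH n e g = nbH n x y ∨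
      nbH n e g = nbH n x (-y) := by
  have ht : ∀ k ∈ signedSet n, k ≠ x → k ≠ -x → k ≠ y → k ≠ -y → nbδ k e = nbδ k g := by
    intro k hk a1 a2 a3 a4
    exact (nb_mem_H.1 (hle (nb_mem_Z.2 ⟨nbδ_mem hk, nbδ_off (by omega) (by omega),
      nbδ_off (by omega) (by omega)⟩))).2
  refine nb_combZ (nbH n) (nbH_comm n) (nbH_neg n) (nbH_neg2 n) ok.2.2 ?_ ?_
  · by_contra c
    push Not at c
    have := ht e ok.1 c.1 c.2.1 c.2.2.1 c.2.2.2
    rw [nbδ_self] at this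
    exact ok.2.2 (nbδ_one this.symm).symm
  · by_contra c
    push Not at c
    have := ht g ok.2.1 c.1 c.2.1 c.2.2.1 c.2.2.2
    rw [nbδ_self] at this
    exact ok.2.2 (nbδ_one this)

structure nbIso (n : ℕ) (γ γ' : Equiv.Perm ℤ) (Φ : Submodule ℝ (ℤ → ℝ) → Submodule ℝ (ℤ → ℝ)) : Prop where
  maps : ∀ W ∈ nbP n γ, Φ W ∈ nbP n γ'
  iff : ∀ W ∈ nbP n γ, ∀ W' ∈ nbP n γ, (W ≤ W' ↔ Φ W ≤ Φ W')
  surj : ∀ U ∈ nbP n γ', ∃ W ∈ nbP n γ, Φ W = U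
  hyp : ∀ x y, nbOK n x y → nbH n x y ∈ nbP n γ

theorem nbIso_inj {n : ℕ} {γ γ' : Equiv.Perm ℤ} {Φ : Submodule ℝ (ℤ → ℝ) → Submodule ℝ (ℤ → ℝ)}
    (I : nbIso n γ γ' Φ) {W W' : Submodule ℝ (ℤ → ℝ)} (h : W ∈ nbP n γ) (h' : W' ∈ nbP n γ)
    (e : Φ W = Φ W') : W = W' :=
  le_antisymm ((I.iff W h W' h').2 e.le) ((I.iff W' h' W h).2 e.symm.le)

theorem nbIso_rank0 {n : ℕ} {γ γ' : Equiv.Perm ℤ} {Φ : Submodule ℝ (ℤ → ℝ) → Submodule ℝ (ℤ → ℝ)}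
    (I : nbIso n γ γ' Φ) (k : ℕ) : ∀ W ∈ nbP n γ, Module.finrank ℝ (Φ W) + k = nbN n →
      Module.finrank ℝ W + k ≤ nbN n := by
  induction k with
  | zero =>
    intro W hW _
    exact nb_le_rank le_rfl (nbP_le hW)
  | succ k ih =>
    intro W hW hk
    have hne : Φ W ≠ nbV n := by
      intro c
      have : nbN n = Module.finrank ℝ (nbV n) := rfl
      rw [c, ← this] at hk
      omega
    obtain ⟨⟨U, hU, hlt, hr⟩, -⟩ := nbP_step (I.maps W hW) hne
    obtain ⟨W', hW', rfl⟩ := I.surj U hU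
    have h1 := ih W' hW' (by omega)
    have h2 : W < W' := by
      rw [lt_iff_le_not_ge, I.iff W hW W' hW', I.iff W' hW' W hW, ← lt_iff_le_not_ge]
      exact hlt
    have := nb_lt_rank (nbP_le hW') h2
    omega

theorem nbIso_rank {n : ℕ} {γ γ' : Equiv.Perm ℤ} {Φ : Submodule ℝ (ℤ → ℝ) → Submodule ℝ (ℤ → ℝ)}
    (I : nbIso n γ γ' Φ) {W : Submodule ℝ (ℤ → ℝ)} (hW : W ∈ nbP n γ) :
    Module.finrank ℝ W ≤ Module.finrank ℝ (Φ W) := by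
  have h : Module.finrank ℝ (Φ W) ≤ nbN n := nb_le_rank le_rfl (nbP_le (I.maps W hW))
  have := nbIso_rank0 I (nbN n - Module.finrank ℝ (Φ W)) W hW (by omega)
  omega

theorem nbIso_ne {n : ℕ} {γ γ' : Equiv.Perm ℤ} {Φ : Submodule ℝ (ℤ → ℝ) → Submodule ℝ (ℤ → ℝ)}
    (I : nbIso n γ γ' Φ) {W : Submodule ℝ (ℤ → ℝ)} (hW : W ∈ nbP n γ) (h : W ≠ nbV n) : Φ W ≠ nbV n := by
  intro c
  apply h
  refine le_antisymm (nbP_le hW) ?_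
  rw [I.iff _ (nbP_V n γ) W hW, c]
  exact nbP_le (I.maps _ (nbP_V n γ))

theorem nbIso_hyp {n : ℕ} {γ γ' : Equiv.Perm ℤ} {Φ : Submodule ℝ (ℤ → ℝ) → Submodule ℝ (ℤ → ℝ)}
    (I : nbIso n γ γ' Φ) {x y : ℤ} (ok : nbOK n x y) : nbRoot n (Φ (nbH n x y)) := by
  have hW := I.hyp x y ok
  obtain ⟨-, a, b, ok', hle⟩ := nbP_step (I.maps _ hW) (nbIso_ne I hW (nbH_lt ok).ne)
  refine ⟨a, b, ok', nb_eq_rank (nbH_le n a b) hle ?_⟩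
  have := nbIso_rank I hW
  have := nbH_rk ok
  have := nbH_rk ok'
  omega

theorem nbIso_Z {n : ℕ} {γ γ' : Equiv.Perm ℤ} {Φ : Submodule ℝ (ℤ → ℝ) → Submodule ℝ (ℤ → ℝ)}
    (I : nbIso n γ γ' Φ) {a b x y : ℤ} (ha : a ∈ signedSet n) (hb : b ∈ signedSet n) (h1 : a ≠ b)
    (h2 : a ≠ -b) (hZ : nbZ n a b ∈ nbP n γ) (ok : nbOK n x y) (hxy : y ≠ -x)
    (e : Φ (nbH n a (-a)) = nbH n x y) : Φ (nbZ n a b) = nbZ n x y := by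
  have oka := nb_okz ha
  have okb := nb_okz hb
  have okab : nbOK n a b := by have := nb_oks (s := 1) (by simp) ha hb h1 h2; rwa [one_mul] at this
  have okab' : nbOK n a (-b) := by
    have := nb_oks (s := -1) (by simp) ha hb h1 h2; rwa [neg_one_mul] at this
  have n1 := nb_ne1 (n := n) hb h1 h2
  have n2 : nbH n a (-a) ≠ nbH n a b := by
    have := nb_ne2 (s := 1) (by simp) hb h1 h2; rwa [one_mul] at this
  have n3 : nbH n a (-a) ≠ nbH n a (-b) := by
    have := nb_ne2 (s := -1) (by simp) hb h1 h2; rwa [neg_one_mul] at this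
  have n4 : nbH n b (-b) ≠ nbH n a b := by
    have := nb_ne3 (s := 1) (by simp) ha h1 h2; rwa [one_mul] at this
  have n5 : nbH n b (-b) ≠ nbH n a (-b) := by
    have := nb_ne3 (s := -1) (by simp) ha h1 h2; rwa [neg_one_mul] at this
  have n6 := nb_ne4 ha hb h1 h2
  have inj : ∀ {x y x' y' : ℤ}, nbOK n x y → nbOK n x' y' → nbH n x y ≠ nbH n x' y' →
      Φ (nbH n x y) ≠ Φ (nbH n x' y') := fun k k' hne c => hne (nbIso_inj I (I.hyp _ _ k) (I.hyp _ _ k') c)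
  have mono : ∀ {x y : ℤ}, nbOK n x y → nbZ n a b ≤ nbH n x y → Φ (nbZ n a b) ≤ Φ (nbH n x y) :=
    fun k hle => (I.iff _ hZ _ (I.hyp _ _ k)).1 hle
  have hr : nbN n ≤ Module.finrank ℝ (Φ (nbZ n a b)) + 2 :=
    (nbHH_rank a (-a) b (-b)).trans (Nat.add_le_add_right (nbIso_rank I hZ) 2)
  have la : nbZ n a b ≤ nbH n a b := fun f hf => by
    have := nb_mem_Z.1 hf
    exact nb_mem_H.2 ⟨this.1, by rw [this.2.1, this.2.2]⟩
  have la' : nbZ n a b ≤ nbH n a (-b) := fun f hf => by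
    have := nb_mem_Z.1 hf
    exact nb_mem_H.2 ⟨this.1, by rw [nb_neg_eq this.1, this.2.1, this.2.2, neg_zero]⟩
  have l0 : Φ (nbZ n a b) ≤ nbH n x y := by rw [← e]; exact mono oka inf_le_left
  have key := nb_four (nbP_le (I.maps _ hZ)) hr ok hxy l0 (nbIso_hyp I okb) (nbIso_hyp I okab)
    (nbIso_hyp I okab') (mono okb inf_le_right) (mono okab la) (mono okab' la')
    (by rw [← e]; exact inj okb oka n1.symm) (by rw [← e]; exact inj okab oka n2.symm)
    (by rw [← e]; exact inj okab' oka n3.symm) (inj okb okab n4) (inj okb okab' n5) (inj okab okab' n6)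
  have hne := ok.2.2
  refine nb_two_eq (nb_okz ok.1) (nb_okz ok.2.1) (nb_ne1 ok.2.1 ok.2.2 (by omega)) hr ?_ ?_
  · intro f hf
    exact nb_mem_z.2 ⟨nbP_le (I.maps _ hZ) hf, key f hf⟩
  · intro f hf
    exact nb_mem_z.2 ⟨nbP_le (I.maps _ hZ) hf, by rw [← (nb_mem_H.1 (l0 hf)).2, key f hf]⟩

theorem nbIso_z {n : ℕ} {γ γ' : Equiv.Perm ℤ} {Φ : Submodule ℝ (ℤ → ℝ) → Submodule ℝ (ℤ → ℝ)}
    (I : nbIso n γ γ' Φ) {a b c : ℤ} (ha : a ∈ signedSet n) (hb : b ∈ signedSet n) (hc : c ∈ signedSet n)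
    (h1 : a ≠ b) (h2 : a ≠ -b) (h3 : a ≠ c) (h4 : a ≠ -c) (h5 : b ≠ c) (h6 : b ≠ -c)
    (hZ : nbZ n a b ∈ nbP n γ) (hZ' : nbZ n a c ∈ nbP n γ) :
    ∃ x : ℤ, 1 ≤ x ∧ x ≤ n ∧ Φ (nbH n a (-a)) = nbH n x (-x) := by
  obtain ⟨x, y, ok, e⟩ := nbIso_hyp I (nb_okz ha)
  by_cases hxy : y = -x
  · subst hxy
    have hs := nb_mem_signed.1 ok.1
    rcases lt_or_gt_of_ne hs.1 with h | h
    · refine ⟨-x, by omega, by omega, ?_⟩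
      rw [e, neg_neg, nbH_comm]
    · exact ⟨x, by omega, by omega, e⟩
  · exfalso
    have e1 := nbIso_Z I ha hb h1 h2 hZ ok hxy e
    have e2 := nbIso_Z I ha hc h3 h4 hZ' ok hxy e
    have e3 := nbIso_inj I hZ hZ' (e1.trans e2.symm)
    have : nbδ c ∈ nbZ n a b := nb_mem_Z.2 ⟨nbδ_mem hc, nbδ_off h3 h4, nbδ_off h5 h6⟩
    rw [e3, nb_mem_Z, nbδ_self] at this
    exact one_ne_zero this.2.2

theorem nbIso_pull {n : ℕ} {γ γ' : Equiv.Perm ℤ} {Φ : Submodule ℝ (ℤ → ℝ) → Submodule ℝ (ℤ → ℝ)}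
    (I : nbIso n γ γ' Φ) {a b x y : ℤ} (hZ : nbZ n a b ∈ nbP n γ)
    (ok : nbOK n x y) (hA : nbH n x y ∈ nbP n γ') (hle : Φ (nbZ n a b) ≤ nbH n x y)
    (h1 : nbH n x y ≠ Φ (nbH n a (-a))) (h2 : nbH n x y ≠ Φ (nbH n b (-b))) :
    ∃ s : ℤ, (s = 1 ∨ s = -1) ∧ nbH n x y = Φ (nbH n a (s * b)) := by
  obtain ⟨W, hW, e⟩ := I.surj _ hA
  have hne : W ≠ nbV n := by
    rintro rfl
    obtain ⟨W', hW', e'⟩ := I.surj _ (nbP_V n γ')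
    have := (I.iff W' hW' _ hW).1 (nbP_le hW')
    rw [e, e'] at this
    exact absurd (nbH_lt ok) (not_lt_of_ge this)
  obtain ⟨-, c, d, okc, hWc⟩ := nbP_step hW hne
  have hWc' := (I.iff W hW _ (I.hyp c d okc)).1 hWc
  obtain ⟨c', d', okc', e'⟩ := nbIso_hyp I okc
  have heq : nbH n x y = Φ (nbH n c d) := by
    rw [e] at hWc'
    rw [e'] at hWc' ⊢
    refine nb_eq_rank (nbH_le n _ _) hWc' ?_
    have := nbH_rk ok; have := nbH_rk okc'; omega
  have hZc : nbZ n a b ≤ nbH n c d := by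
    rw [I.iff _ hZ _ (I.hyp c d okc), ← heq]; exact hle
  rcases nb_Zroot okc hZc with h | h | h | h
  · rw [h] at heq; exact absurd heq h1
  · rw [h] at heq; exact absurd heq h2
  · exact ⟨1, by simp, by rw [heq, h, one_mul]⟩
  · exact ⟨-1, by simp, by rw [heq, h, neg_one_mul]⟩

theorem nb_Z_le {n : ℕ} {x y s : ℤ} (hs : s = 1 ∨ s = -1) {U : Submodule ℝ (ℤ → ℝ)}
    (h1 : U ≤ nbH n x (-x)) (h2 : U ≤ nbH n y (-y)) : U ≤ nbH n x (s * y) := by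
  intro f hf
  have a1 := nb_mem_z.1 (h1 hf)
  have a2 := nb_mem_z.1 (h2 hf)
  exact nb_mem_H.2 ⟨a1.1, by rw [nb_sval hs a1.1, a1.2, a2.2, mul_zero]⟩

theorem nb_final (p : ℕ) (hp : 2 ≤ p) (Φ : Submodule ℝ (ℤ → ℝ) → Submodule ℝ (ℤ → ℝ))
    (I : nbIso (p+1) (gammaPQ p 1) (gammaDisc (p+1)) Φ) : False := by
  have s1 : (1:ℤ) ∈ signedSet (p+1) := nb_mem_signed.2 (by omega)
  have s2 : (2:ℤ) ∈ signedSet (p+1) := nb_mem_signed.2 (by omega)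
  have s3 : (p:ℤ)+1 ∈ signedSet (p+1) := nb_mem_signed.2 (by omega)
  have Zc : ∀ a b, nbZ (p+1) a b = nbZ (p+1) b a := fun a b => inf_comm _ _
  have Z31 : nbZ (p+1) ((p:ℤ)+1) 1 ∈ nbP (p+1) (gammaPQ p 1) := nb_Zin hp 1 (by omega) (by omega)
  have Z32 : nbZ (p+1) ((p:ℤ)+1) 2 ∈ nbP (p+1) (gammaPQ p 1) := nb_Zin hp 2 (by omega) (by omega)
  have Z13 := Z31
  have Z23 := Z32
  rw [Zc] at Z13 Z23
  have Z12 : nbZ (p+1) 1 2 ∈ nbP (p+1) (gammaPQ p 1) := by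
    have e : nbZ (p+1) 1 2 = nbH (p+1) 1 (-1) ⊓ nbH (p+1) 1 2 := by
      ext f
      rw [nb_mem_Z, Submodule.mem_inf, nb_mem_z, nb_mem_H]
      constructor
      · rintro ⟨a, b, c⟩; exact ⟨⟨a, b⟩, a, b.trans c.symm⟩
      · rintro ⟨⟨a, b⟩, _, c⟩; exact ⟨a, b, c.symm.trans b⟩
    rw [e]; exact nb_Z12 hp
  have Z21 := Z12
  rw [Zc] at Z21
  obtain ⟨x1, l1, u1, e1⟩ := nbIso_z I s1 s2 s3 (by omega) (by omega) (by omega) (by omega) (by omega) (by omega) Z12 Z13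
  obtain ⟨x2, l2, u2, e2⟩ := nbIso_z I s2 s1 s3 (by omega) (by omega) (by omega) (by omega) (by omega) (by omega) Z21 Z23
  obtain ⟨x3, l3, u3, e3⟩ := nbIso_z I s3 s1 s2 (by omega) (by omega) (by omega) (by omega) (by omega) (by omega) Z31 Z32
  have t1 : x1 ∈ signedSet (p+1) := nb_mem_signed.2 (by omega)
  have t2 : x2 ∈ signedSet (p+1) := nb_mem_signed.2 (by omega)
  have t3 : x3 ∈ signedSet (p+1) := nb_mem_signed.2 (by omega)
  have m1 := I.hyp _ _ (nb_okz s1)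
  have m2 := I.hyp _ _ (nb_okz s2)
  have m3 := I.hyp _ _ (nb_okz s3)
  have d12 : x1 ≠ x2 := by
    rintro rfl
    exact nb_ne1 s2 (by omega) (by omega) (nbIso_inj I m1 m2 (e1.trans e2.symm))
  have d13 : x1 ≠ x3 := by
    rintro rfl
    exact nb_ne1 s3 (by omega) (by omega) (nbIso_inj I m1 m3 (e1.trans e3.symm))
  have d23 : x2 ≠ x3 := by
    rintro rfl
    exact nb_ne1 s3 (by omega) (by omega) (nbIso_inj I m2 m3 (e2.trans e3.symm))
  obtain ⟨s, t, hs, ht, hbad⟩ := nb_bad l1 u1 l2 u2 l3 u3 d12 d23 d13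
  have hγ := nbγ_inB (p+1)
  have h0 := nbγ_F (p+1) (by omega)
  have okA := nb_oks hs t1 t2 d12 (by omega)
  have okB := nb_oks ht t2 t3 d23 (by omega)
  have lA : Φ (nbZ (p+1) 1 2) ≤ nbH (p+1) x1 (s * x2) := by
    refine nb_Z_le hs ?_ ?_
    · rw [← e1]; exact (I.iff _ Z12 _ m1).1 inf_le_left
    · rw [← e2]; exact (I.iff _ Z12 _ m2).1 inf_le_right
  have lB : Φ (nbZ (p+1) 2 ((p:ℤ)+1)) ≤ nbH (p+1) x2 (t * x3) := by
    refine nb_Z_le ht ?_ ?_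
    · rw [← e2]; exact (I.iff _ Z23 _ m2).1 inf_le_left
    · rw [← e3]; exact (I.iff _ Z23 _ m3).1 inf_le_right
  obtain ⟨s', hs', eA⟩ := nbIso_pull I Z12 okA (nbP_H hγ h0 okA) lA
    (by rw [e1]; exact (nb_ne2 hs t2 d12 (by omega)).symm)
    (by rw [e2]; exact (nb_ne3 hs t1 d12 (by omega)).symm)
  obtain ⟨t', ht', eB⟩ := nbIso_pull I Z23 okB (nbP_H hγ h0 okB) lB
    (by rw [e2]; exact (nb_ne2 ht t3 d23 (by omega)).symm)
    (by rw [e3]; exact (nb_ne3 ht t2 d23 (by omega)).symm)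
  obtain ⟨T, hT, hT1, hT2, hT3⟩ := nb_T hp s' t' hs' ht'
  apply hT3
  rw [I.iff T hT _ m1, e1]
  refine hbad _ (I.maps T hT) ?_ ?_
  · rw [eA]
    exact (I.iff T hT _ (I.hyp _ _ (nb_oks hs' s1 s2 (by omega) (by omega)))).1 hT1
  · rw [eB]
    exact (I.iff T hT _ (I.hyp _ _ (nb_oks ht' s2 s3 (by omega) (by omega)))).1 hT2

/-- For every integer `n ≥ 3`, the posets `NC^B(n-1,1)` and `NC^B(n)`
are not order-isomorphic. -/
theorem ncb_nm1_1_not_iso_ncb_n (n : ℕ) (hn : 3 ≤ n) :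
    ¬ ∃ f : Set (Set ℤ) → Set (Set ℤ),
        Set.BijOn f (NCB (n - 1) 1) (NCBdisc n) ∧
        ∀ x ∈ NCB (n - 1) 1, ∀ y ∈ NCB (n - 1) 1,
          (refines x y ↔ refines (f x) (f y)) := by
  rintro ⟨f, hb, ho⟩
  obtain ⟨p, rfl⟩ : ∃ p, n = p + 1 := ⟨n - 1, by omega⟩
  rw [Nat.add_sub_cancel] at hb ho
  obtain ⟨Φ, h1, h2, h3⟩ := nb_reduce p (by omega) f hb ho
  exact nb_final p (by omega) Φ ⟨h1, h2, h3, fun x y ok => nbP_H (nbpq_inB p) (nbpq_F p (by omega)) ok⟩
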